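/- Convergence of the scaled supremum (reflected) processes (Lemma 2, light traffic). Assume that r_i(u) → ∞ as u → ∞ for every i ∈ {1,…,n} and that the model satisfies L1, L2, N1, N2 and N3. Then, as u → ∞, the process X̄ᵟ_u(·), with components X̄ᵟ_{u,i}(t) = X̄_{u,i}(δ(r_i(u))t)/σ(δ(r_i(u))), converges in distribution in C([0,∞) → ℝⁿ) to 𝔛_λ(·). -/

import Mathlib

open MeasureTheory ProbabilityTheory Filter Topology

noncomputable section

/-- Covariance function of a centered Gaussian process with stationary increments
and standard deviation function `σ`:
`Cov(J(t), J(s)) = (σ²(|t|) + σ²(|s|) − σ²(|t−s|))/2`. -/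
def covFromStd (σ : ℝ → ℝ) : ℝ → ℝ → ℝ := fun t s =>
  (σ |t| ^ 2 + σ |s| ^ 2 - σ |t - s| ^ 2) / 2

/-- `X` is a real-valued centered Gaussian process (indexed by `ℝ`) with covariance
function `K`, under the measure `P`: every finite linear combination of its values is a
centered Gaussian real random variable with the variance prescribed by `K`. -/
def IsCenteredGaussian1 {Ω : Type*} [MeasurableSpace Ω] (P : Measure Ω)
    (X : ℝ → Ω → ℝ) (K : ℝ → ℝ → ℝ) : Prop :=
  (∀ t, Measurable (X t)) ∧
  ∀ (k : ℕ) (t : Fin k → ℝ) (c : Fin k → ℝ),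
    P.map (fun ω => ∑ a, c a * X (t a) ω)
      = gaussianReal 0 (∑ a, ∑ b, c a * c b * K (t a) (t b)).toNNReal

/-- `X` is an `n`-dimensional centered Gaussian process with matrix covariance function
`K` (`K i j t s = Cov(Xᵢ(t), Xⱼ(s))`) under the measure `P`. -/
def IsCenteredGaussianVec {Ω : Type*} [MeasurableSpace Ω] {n : ℕ} (P : Measure Ω)
    (X : ℝ → Ω → Fin n → ℝ) (K : Fin n → Fin n → ℝ → ℝ → ℝ) : Prop :=
  (∀ t i, Measurable fun ω => X t ω i) ∧
  ∀ (k : ℕ) (t : Fin k → ℝ) (c : Fin k → Fin n → ℝ),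
    P.map (fun ω => ∑ a, ∑ i, c a i * X (t a) ω i)
      = gaussianReal 0
          (∑ a, ∑ b, ∑ i, ∑ j, c a i * c b j * K i j (t a) (t b)).toNNReal

/-- Covariance of the limiting fractional-Brownian-type process with Hurst-type
parameter `h` and rate ratio `ρv`; the exponent `1/(h−1)` equals `−κ` in the
light-traffic case (`h = λ`, `κ = (1−λ)⁻¹`) and `ξ` in the heavy-traffic case (`h = α`). -/
def limCov (h ρv t s : ℝ) : ℝ :=
  if 0 < ρv then
    (|t| ^ (2 * h) + |ρv ^ (1 / (h - 1)) * s| ^ (2 * h)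
        - |t - ρv ^ (1 / (h - 1)) * s| ^ (2 * h)) / (2 * ρv ^ (1 / (h - 1) * h))
  else 0

/-- Matrix covariance function of the limiting `n`-dimensional Gaussian process `B`. -/
def limCovMat {n : ℕ} (h : ℝ) (ρ : Fin n → Fin n → ℝ) (i j : Fin n) (t s : ℝ) : ℝ :=
  if i ≤ j then limCov h (ρ i j) t s else limCov h (ρ j i) s t

/-- The stationary reflected (workload) map:
`X̄(t) = sup_{−∞ < s < t} (c (J(t) − J(s)) − rate (t − s))`. -/
def XbarProc {Ω : Type*} (J : ℝ → Ω → ℝ) (c rate t : ℝ) (ω : Ω) : ℝ :=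
  ⨆ s : Set.Iio t, (c * (J t ω - J (↑s) ω) - rate * (t - ↑s))

/-- Convergence in distribution, as `u → ∞`, of the processes `X u` (on `(Ω, P)`) to `Y`
(on `(Ω', P')`), viewed as random elements of the space of functions on `I` carrying the
topology of uniform convergence on compact subsets of `I`: the expectations of every
bounded continuous functional converge. -/
def TendstoInDistOnCompacts {Ω Ω' : Type*} [MeasurableSpace Ω] [MeasurableSpace Ω']
    (P : Measure Ω) (P' : Measure Ω') (I : Set ℝ) (n : ℕ)
    (X : ℝ → Ω → ℝ → Fin n → ℝ) (Y : Ω' → ℝ → Fin n → ℝ) : Prop :=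
  ∀ F : BoundedContinuousFunction
      (UniformOnFun ↥I (Fin n → ℝ) {K : Set ↥I | IsCompact K}) ℝ,
    Tendsto
      (fun u => ∫ ω, F (UniformOnFun.ofFun {K : Set ↥I | IsCompact K}
          (fun t : ↥I => X u ω ↑t)) ∂P)
      atTop
      (𝓝 (∫ ω, F (UniformOnFun.ofFun {K : Set ↥I | IsCompact K}
          (fun t : ↥I => Y ω ↑t)) ∂P'))


open MeasureTheory ProbabilityTheory Filter Topology

/-- one-step dyadic bounds near zero, from regular variation -/
lemma rv_dyadic_step {σ : ℝ → ℝ} (hσpos : ∀ t > (0:ℝ), 0 < σ t) {lam a b : ℝ}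
    (hL1 : ∀ t > (0:ℝ), Tendsto (fun x => σ (t * x) / σ x) (𝓝[>] 0) (𝓝 (t ^ lam)))
    (ha : a < lam) (hb : lam < b) :
    ∃ x1 > (0:ℝ), ∀ x, 0 < x → x < x1 →
      σ (x / 2) ≤ (2:ℝ) ^ (-a) * σ x ∧ σ (2 * x) ≤ (2:ℝ) ^ b * σ x := by
  have h1 : ∀ᶠ x in 𝓝[>] (0:ℝ), σ ((1/2) * x) / σ x < (2:ℝ) ^ (-a) := by
    refine (hL1 (1/2) (by norm_num)).eventually_lt_const ?_
    rw [one_div, Real.inv_rpow (by norm_num), ← Real.rpow_neg (by norm_num)]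
    exact Real.rpow_lt_rpow_of_exponent_lt (by norm_num) (by linarith)
  have h2 : ∀ᶠ x in 𝓝[>] (0:ℝ), σ (2 * x) / σ x < (2:ℝ) ^ b := by
    refine (hL1 2 (by norm_num)).eventually_lt_const ?_
    exact Real.rpow_lt_rpow_of_exponent_lt (by norm_num) (by linarith)
  obtain ⟨x1, hx1, h⟩ := mem_nhdsGT_iff_exists_Ioo_subset.1 (h1.and h2)
  refine ⟨x1, hx1, fun x hx0 hx => ?_⟩
  obtain ⟨g1, g2⟩ := h ⟨hx0, hx⟩
  have hp := hσpos x hx0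
  rw [div_lt_iff₀ hp] at g1 g2
  refine ⟨?_, g2.le⟩
  rw [show x / 2 = 1/2 * x by ring]; exact g1.le

lemma rv_max_bound {σ : ℝ → ℝ} (hσcont : ContinuousOn σ (Set.Ici 0)) (hσ0 : σ 0 = 0)
    (hσpos : ∀ t > (0:ℝ), 0 < σ t)
    (hsub : ∀ x y : ℝ, 0 ≤ x → 0 ≤ y → σ (x + y) ≤ σ x + σ y)
    {θ x1 : ℝ} (hθ0 : 0 < θ) (hθ1 : θ < 1)
    (hstep : ∀ x, 0 < x → x < x1 → σ (x / 2) ≤ θ * σ x) :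
    (∀ (k : ℕ) x, 0 < x → x < x1 → σ (x / 2 ^ k) ≤ θ ^ k * σ x) ∧
    ∀ x y, 0 < x → x < x1 → 0 ≤ y → y ≤ x → σ y ≤ 2 / (1 - θ) * σ x := by
  have hpow : ∀ (k : ℕ) x, 0 < x → x < x1 → σ (x / 2 ^ k) ≤ θ ^ k * σ x := by
    intro k
    induction k with
    | zero => intro x _ _; simp
    | succ k ih =>
      intro x hx hx1
      have e : x / 2 ^ (k+1) = (x / 2 ^ k) / 2 := by field_simp; ring
      have hle : x / 2 ^ k ≤ x := div_le_self hx.le (one_le_pow₀ (by norm_num))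
      rw [e]
      calc σ (x / 2 ^ k / 2) ≤ θ * σ (x / 2 ^ k) := hstep _ (by positivity) (lt_of_le_of_lt hle hx1)
        _ ≤ θ * (θ ^ k * σ x) := by gcongr; exact ih x hx hx1
        _ = _ := by ring
  refine ⟨hpow, ?_⟩
  intro x y hx hx1 hy hyx
  have hsx := hσpos x hx
  have key : ∀ k : ℕ, ∃ z, 0 ≤ z ∧ z ≤ x / 2 ^ k ∧
      σ y ≤ σ x * (∑ j ∈ Finset.range k, θ ^ (j+1)) + σ z := by
    intro k
    induction k with
    | zero => exact ⟨y, hy, by simpa using hyx, by simp⟩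
    | succ k ih =>
      obtain ⟨z, hz0, hz, hyz⟩ := ih
      rw [Finset.sum_range_succ]
      by_cases hc : z ≤ x / 2 ^ (k+1)
      · refine ⟨z, hz0, hc, hyz.trans ?_⟩
        have : 0 ≤ σ x * θ ^ (k+1) := by positivity
        nlinarith
      · push Not at hc
        refine ⟨z - x / 2 ^ (k+1), by linarith, ?_, ?_⟩
        · have : x / 2 ^ k = x / 2 ^ (k+1) + x / 2 ^ (k+1) := by field_simp; ring
          linarith
        · have h1 := hsub (x / 2 ^ (k+1)) (z - x / 2 ^ (k+1)) (by positivity) (by linarith)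
          rw [add_sub_cancel] at h1
          have h2 := hpow (k+1) x hx hx1
          nlinarith
  choose z hz0 hz hyz using key
  have hzt : Tendsto z atTop (𝓝 0) := by
    have : Tendsto (fun k : ℕ => x / 2 ^ k) atTop (𝓝 0) := by
      have h := (tendsto_pow_atTop_nhds_zero_of_lt_one (r := (1/2:ℝ)) (by norm_num) (by norm_num)).const_mul x
      simpa [div_eq_mul_inv] using h
    exact tendsto_of_tendsto_of_tendsto_of_le_of_le tendsto_const_nhds this hz0 hz
  have hσz : Tendsto (fun k => σ (z k)) atTop (𝓝 0) := by
    have h := hσcont 0 (Set.mem_Ici.2 le_rfl)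
    rw [ContinuousWithinAt, hσ0] at h
    exact h.comp (tendsto_nhdsWithin_iff.2 ⟨hzt, Eventually.of_forall hz0⟩)
  have hsum : ∀ k : ℕ, (∑ j ∈ Finset.range k, θ ^ (j+1)) ≤ 1 / (1 - θ) := by
    intro k
    have h1 : (∑ j ∈ Finset.range k, θ ^ (j+1)) = θ * ∑ j ∈ Finset.range k, θ ^ j := by
      rw [Finset.mul_sum]; exact Finset.sum_congr rfl fun j _ => by ring
    have h2 : (∑ j ∈ Finset.range k, θ ^ j) ≤ 1 / (1 - θ) := by
      rw [geom_sum_eq hθ1.ne]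
      rw [← neg_sub 1 θ, div_neg, ← neg_div]
      have : 0 < θ ^ k := by positivity
      gcongr
      linarith
    have h3 : (0:ℝ) ≤ ∑ j ∈ Finset.range k, θ ^ j := Finset.sum_nonneg fun j _ => by positivity
    rw [h1]; nlinarith
  have hlim : σ y ≤ σ x * (1 / (1-θ)) + 0 := by
    refine ge_of_tendsto' (hσz.const_add (σ x * (1/(1-θ)))) fun k => (hyz k).trans ?_
    gcongr
    exact hsum k
  have : 0 ≤ σ x * (1/(1-θ)) := by
    have : 0 < 1 - θ := by linarith
    positivity
  have e : 2 / (1 - θ) * σ x = 2 * (σ x * (1/(1-θ))) := by ring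
  rw [e]; linarith

lemma rv_potter {σ : ℝ → ℝ} (hσcont : ContinuousOn σ (Set.Ici 0)) (hσ0 : σ 0 = 0)
    (hσpos : ∀ t > (0:ℝ), 0 < σ t)
    (hsub : ∀ x y : ℝ, 0 ≤ x → 0 ≤ y → σ (x + y) ≤ σ x + σ y)
    {lam : ℝ} (hlam : lam ∈ Set.Ioo (0:ℝ) 1)
    (hL1 : ∀ t > (0:ℝ), Tendsto (fun x => σ (t * x) / σ x) (𝓝[>] 0) (𝓝 (t ^ lam)))
    {t₀ β C : ℝ} (ht₀ : 0 < t₀) (hβ : β ∈ Set.Ioo (0:ℝ) 1) (hC : 0 < C)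
    (hL2 : ∀ t > t₀, σ t ≤ C * t ^ β) :
    ∃ K a b d : ℝ, 0 < K ∧ 0 < a ∧ a < lam ∧ lam < b ∧ b < 1 ∧ 0 < d ∧
      ∀ x t, 0 < x → x ≤ d → 0 ≤ t → σ (t * x) ≤ K * (t ^ a + t ^ b) * σ x := by
  obtain ⟨hl0, hl1⟩ := hlam
  obtain ⟨hβ0, hβ1⟩ := hβ
  obtain ⟨a, ha0, hal⟩ := exists_between hl0
  obtain ⟨b, hb, hb1⟩ := exists_between (max_lt hl1 hβ1)
  have hlb : lam < b := lt_of_le_of_lt (le_max_left _ _) hb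
  have hβb : β < b := lt_of_le_of_lt (le_max_right _ _) hb
  obtain ⟨x1, hx1, hst⟩ := rv_dyadic_step hσpos hL1 hal hlb
  set θ : ℝ := 2 ^ (-a) with hθ
  have hθ0 : 0 < θ := by positivity
  have hθ1 : θ < 1 := Real.rpow_lt_one_of_one_lt_of_neg (by norm_num) (by linarith)
  obtain ⟨hpow, hmax⟩ := rv_max_bound hσcont hσ0 hσpos hsub hθ0 hθ1 (fun x h h' => (hst x h h').1)
  set K1 : ℝ := 2 / (1 - θ) with hK1
  have hK1p : 0 < K1 := div_pos (by norm_num) (by linarith)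
  set d : ℝ := x1 / 4 with hd
  have hd0 : 0 < d := by positivity
  -- small t
  have small : ∀ x t, 0 < x → x ≤ d → 0 < t → t ≤ 1 → σ (t * x) ≤ K1 * 2 ^ a * t ^ a * σ x := by
    intro x t hx hxd ht ht1
    have hxx : x < x1 := by linarith
    obtain ⟨k, hk1, hk2⟩ := exists_nat_pow_near_of_lt_one ht ht1 (y := (1/2:ℝ)) (by norm_num) (by norm_num)
    have hle : t * x ≤ x / 2 ^ k := by
      have : x / 2 ^ k = (1/2:ℝ) ^ k * x := by rw [one_div, inv_pow]; field_simp
      rw [this]; gcongr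
    have h1 : x / 2 ^ k ≤ x := div_le_self hx.le (one_le_pow₀ (by norm_num))
    have hsx := hσpos x hx
    calc σ (t * x) ≤ K1 * σ (x / 2 ^ k) := hmax _ _ (by positivity) (by linarith) (by positivity) hle
      _ ≤ K1 * (θ ^ k * σ x) := by gcongr; exact hpow k x hx hxx
      _ ≤ K1 * ((2 ^ a * t ^ a) * σ x) := by
          gcongr
          rw [← Real.mul_rpow (by norm_num) ht.le]
          have : θ ^ k = ((1/2:ℝ) ^ k) ^ a := by
            rw [hθ, ← Real.rpow_natCast, ← Real.rpow_natCast, ← Real.rpow_mul (by norm_num), 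
              ← Real.rpow_mul (by norm_num), one_div, Real.inv_rpow (by norm_num), ← Real.rpow_neg (by norm_num)]
            congr 1; ring
          rw [this]
          apply Real.rpow_le_rpow (by positivity) _ ha0.le
          rw [pow_succ] at hk1; linarith
      _ = _ := by ring
  have bigpow : ∀ (k : ℕ) y, 0 < y → 2 ^ k * y < x1 → σ (2 ^ k * y) ≤ (2 ^ b) ^ k * σ y := by
    intro k
    induction k with
    | zero => intro y _ _; simp
    | succ k ih =>
      intro y hy hky
      have e : (2:ℝ) ^ (k+1) * y = 2 * (2 ^ k * y) := by ring
      have hlt : 2 ^ k * y < x1 := by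
        have : 0 < (2:ℝ) ^ k * y := by positivity
        rw [e] at hky; linarith
      rw [e]
      calc σ (2 * (2 ^ k * y)) ≤ 2 ^ b * σ (2 ^ k * y) := (hst _ (by positivity) hlt).2
        _ ≤ 2 ^ b * ((2 ^ b) ^ k * σ y) := by gcongr; exact ih y hy hlt
        _ = _ := by ring
  have mid : ∀ x t, 0 < x → x ≤ d → 1 ≤ t → t * x ≤ d → σ (t * x) ≤ K1 * 2 ^ b * t ^ b * σ x := by
    intro x t hx hxd ht htx
    obtain ⟨k, hk1, hk2⟩ := exists_nat_pow_near ht (y := (2:ℝ)) (by norm_num)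
    have ht0 : 0 < t := by linarith
    set y := t * x / 2 ^ k with hy
    have hy0 : 0 < y := by positivity
    have e : 2 ^ k * y = t * x := by rw [hy]; field_simp
    have hy2 : y ≤ 2 * x := by
      rw [hy, div_le_iff₀ (by positivity)]
      rw [pow_succ] at hk2
      nlinarith
    have hsx := hσpos x hx
    calc σ (t * x) = σ (2 ^ k * y) := by rw [e]
      _ ≤ (2 ^ b) ^ k * σ y := bigpow k y hy0 (by rw [e]; linarith)
      _ ≤ (2 ^ b) ^ k * (K1 * σ (2 * x)) := by
          gcongr; exact hmax _ _ (by linarith) (by linarith) hy0.le hy2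
      _ ≤ (2 ^ b) ^ k * (K1 * (2 ^ b * σ x)) := by gcongr; exact (hst x hx (by linarith)).2
      _ ≤ t ^ b * (K1 * (2 ^ b * σ x)) := by
          gcongr
          rw [← Real.rpow_natCast, ← Real.rpow_mul (by norm_num), mul_comm, Real.rpow_mul (by norm_num), Real.rpow_natCast]
          exact Real.rpow_le_rpow (by positivity) hk1 (by linarith)
      _ = _ := by ring
  have far : ∃ C' > 0, ∀ y, d ≤ y → σ y ≤ C' * y ^ b := by
    have hcpt : IsCompact (Set.Icc d (max d t₀)) := isCompact_Icc
    obtain ⟨M, hM⟩ := (hcpt.bddAbove_image (hσcont.mono (fun z hz => Set.mem_Ici.2 (hd0.le.trans hz.1))))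
    have hM' : ∀ y ∈ Set.Icc d (max d t₀), σ y ≤ M := fun y hy => hM (Set.mem_image_of_mem _ hy)
    have hM0 : 0 < M := (hσpos d hd0).trans_le (hM' d ⟨le_rfl, le_max_left _ _⟩)
    refine ⟨M / d ^ b + C * d ^ (β - b), by positivity, fun y hy => ?_⟩
    have hy0 : 0 < y := by linarith
    have hdb : 0 < d ^ b := by positivity
    have hyb : d ^ b ≤ y ^ b := Real.rpow_le_rpow hd0.le hy (by linarith)
    have hyb0 : 0 < y ^ b := by positivity
    have p1 : 0 ≤ M / d ^ b * y ^ b := by positivity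
    have p2 : 0 ≤ C * d ^ (β - b) * y ^ b := by positivity
    rw [add_mul]
    by_cases hyt : y ≤ t₀
    · have := hM' y ⟨hy, hyt.trans (le_max_right _ _)⟩
      have : M ≤ M / d ^ b * y ^ b := by
        rw [div_mul_eq_mul_div, le_div_iff₀ hdb]; gcongr
      linarith
    · push Not at hyt
      have h1 := hL2 y hyt
      have h2 : y ^ β ≤ d ^ (β - b) * y ^ b := by
        have : y ^ β = y ^ (β - b) * y ^ b := by rw [← Real.rpow_add hy0]; congr 1; ring
        rw [this]; gcongr ?_ * _
        exact Real.rpow_le_rpow_of_nonpos hd0 hy (by linarith)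
      have : C * y ^ β ≤ C * (d ^ (β - b) * y ^ b) := by gcongr
      linarith
  obtain ⟨C', hC', hfar⟩ := far
  have hsd := hσpos d hd0
  refine ⟨K1 * 2 ^ a + K1 * 2 ^ b + C' * (d ^ b * (K1 * 2 ^ b) / σ d), a, b, d, by positivity, ha0, hal, hlb, hb1, hd0, ?_⟩
  intro x t hx hxd ht
  have hsx := hσpos x hx
  rcases ht.eq_or_lt with rfl | ht
  · rw [zero_mul, hσ0]; positivity
  have hta : 0 < t ^ a := by positivity
  have htb : 0 < t ^ b := by positivity
  have p1 : 0 < K1 * 2 ^ a := by positivity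
  have p2 : 0 < K1 * 2 ^ b := by positivity
  have p3 : 0 < C' * (d ^ b * (K1 * 2 ^ b) / σ d) := by positivity
  by_cases ht1 : t ≤ 1
  · refine (small x t hx hxd ht ht1).trans ?_
    gcongr
    · linarith
    · linarith
  · push Not at ht1
    by_cases htx : t * x ≤ d
    · refine (mid x t hx hxd ht1.le htx).trans ?_
      gcongr
      · linarith
      · linarith
    · push Not at htx
      have h1 := hfar _ htx.le
      have h2 := mid x (d / x) hx hxd ((one_le_div hx).2 hxd) (by rw [div_mul_cancel₀ _ hx.ne'])
      rw [div_mul_cancel₀ _ hx.ne', Real.div_rpow hd0.le hx.le] at h2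
      have hxb : 0 < x ^ b := by positivity
      have h3 : x ^ b ≤ d ^ b * (K1 * 2 ^ b) / σ d * σ x := by
        rw [div_mul_eq_mul_div, le_div_iff₀ hsd]
        calc x ^ b * σ d ≤ x ^ b * (K1 * 2 ^ b * (d ^ b / x ^ b) * σ x) := by gcongr
          _ = _ := by field_simp
      calc σ (t * x) ≤ C' * (t * x) ^ b := h1
        _ = C' * (t ^ b * x ^ b) := by rw [Real.mul_rpow ht.le hx.le]
        _ ≤ C' * (t ^ b * (d ^ b * (K1 * 2 ^ b) / σ d * σ x)) := by gcongr
        _ = (C' * (d ^ b * (K1 * 2 ^ b) / σ d)) * t ^ b * σ x := by ring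
        _ ≤ _ := by
          gcongr
          · linarith
          · linarith

open MeasureTheory ProbabilityTheory Filter Topology

lemma ev_small {ι : Type*} {l : Filter ι} {x : ι → ℝ} {d : ℝ} (hd : 0 < d)
    (hx : Tendsto x l (𝓝[>] 0)) : ∀ᶠ u in l, 0 < x u ∧ x u ≤ d := by
  have h : ∀ᶠ y in 𝓝[>] (0:ℝ), 0 < y ∧ y ≤ d := by
    filter_upwards [Ioo_mem_nhdsGT hd] with y hy using ⟨hy.1, hy.2.le⟩
  exact hx.eventually h

/-- Collected properties of the standard deviation function. -/
structure SigHyp (σ : ℝ → ℝ) (lam K a b d : ℝ) : Prop where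
  zero : σ 0 = 0
  pos : ∀ t > (0:ℝ), 0 < σ t
  sub : ∀ x y : ℝ, σ |x + y| ≤ σ |x| + σ |y|
  cs : ∀ x h w : ℝ, |(σ |x| ^ 2 - σ |x - h| ^ 2) - (σ |x + w| ^ 2 - σ |x + w - h| ^ 2)|
    ≤ 2 * (σ |h| * σ |w|)
  l0 : 0 < lam
  l1 : lam < 1
  L1 : ∀ t > (0:ℝ), Tendsto (fun x => σ (t * x) / σ x) (𝓝[>] 0) (𝓝 (t ^ lam))
  K0 : 0 < K
  a0 : 0 < a
  al : a < lam
  lb : lam < b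
  b1 : b < 1
  d0 : 0 < d
  potter : ∀ x t, 0 < x → x ≤ d → 0 ≤ t → σ (t * x) ≤ K * (t ^ a + t ^ b) * σ x

namespace SigHyp
variable {σ : ℝ → ℝ} {lam K a b d : ℝ}

lemma nonneg (H : SigHyp σ lam K a b d) (x : ℝ) : 0 ≤ σ |x| := by
  rcases (abs_nonneg x).eq_or_lt with h | h
  · rw [← h, H.zero]
  · exact (H.pos _ h).le

lemma lip (H : SigHyp σ lam K a b d) (x y : ℝ) : |(σ |x|) - (σ |y|)| ≤ σ |x - y| := by
  have h1 := H.sub (x - y) y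
  have h2 := H.sub (y - x) x
  rw [sub_add_cancel] at h1 h2
  rw [abs_sub_comm y x] at h2
  rw [abs_le]; constructor <;> linarith

lemma b0 (H : SigHyp σ lam K a b d) : 0 < b := H.l0.trans H.lb

/-- Locally uniform convergence. -/
lemma tendsto_ratio (H : SigHyp σ lam K a b d) {ι : Type*} {l : Filter ι} {x τ : ι → ℝ} {t : ℝ}
    (hx : Tendsto x l (𝓝[>] 0)) (hτ : Tendsto τ l (𝓝 t)) :
    Tendsto (fun u => σ |x u * τ u| / σ (x u)) l (𝓝 (|t| ^ lam)) := by
  have hxd : ∀ᶠ u in l, 0 < x u ∧ x u ≤ d :=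
    ev_small H.d0 hx
  have h1 : Tendsto (fun u => σ |x u * t| / σ (x u)) l (𝓝 (|t| ^ lam)) := by
    rcases eq_or_ne t 0 with rfl | ht
    · simp only [mul_zero, abs_zero, H.zero, zero_div]
      rw [Real.zero_rpow H.l0.ne']; exact tendsto_const_nhds
    · refine ((H.L1 |t| (abs_pos.2 ht)).comp hx).congr' ?_
      filter_upwards [hxd] with u hu
      simp only [Function.comp]
      rw [abs_mul, abs_of_pos hu.1, mul_comm]
  have h2 : Tendsto (fun u => σ |x u * τ u| / σ (x u) - σ |x u * t| / σ (x u)) l (𝓝 0) := by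
    have hb : Tendsto (fun u => K * (|τ u - t| ^ a + |τ u - t| ^ b)) l (𝓝 0) := by
      have h3 : Tendsto (fun u => |τ u - t|) l (𝓝 0) := by
        have := (hτ.sub_const t).abs
        simpa using this
      have h4 := (h3.rpow_const (p := a) (Or.inr H.a0.le)).add (h3.rpow_const (p := b) (Or.inr H.b0.le))
      rw [Real.zero_rpow H.a0.ne', Real.zero_rpow H.b0.ne'] at h4
      simpa using h4.const_mul K
    refine squeeze_zero_norm' ?_ hb
    filter_upwards [hxd] with u hu
    have hs := H.pos _ hu.1
    rw [← sub_div, Real.norm_eq_abs, abs_div, abs_of_pos hs, div_le_iff₀ hs]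
    refine (H.lip _ _).trans ?_
    rw [← mul_sub, abs_mul, abs_of_pos hu.1, mul_comm (x u)]
    exact H.potter _ _ hu.1 hu.2 (abs_nonneg _)
  have := h2.add h1
  simpa using this

/-- Scaling: bound on the ratio `q = y / x` from both sides. -/
lemma ratio_le (H : SigHyp σ lam K a b d) {x y : ℝ} (hx : 0 < x) (hxd : x ≤ d) (hy : 0 < y) :
    (σ y / y) / (σ x / x) ≤ K * ((y / x) ^ (a - 1) + (y / x) ^ (b - 1)) := by
  have hq : 0 < y / x := by positivity
  have h := H.potter x (y / x) hx hxd hq.le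
  rw [div_mul_cancel₀ _ hx.ne'] at h
  have hs := H.pos x hx
  rw [Real.rpow_sub_one hq.ne', Real.rpow_sub_one hq.ne', ← add_div]
  rw [div_div_div_eq, div_le_iff₀ (by positivity)]
  calc σ y * x ≤ (K * ((y / x) ^ a + (y / x) ^ b) * σ x) * x := by gcongr
    _ = _ := by
      generalize (y / x) ^ a + (y / x) ^ b = w
      field_simp

lemma ratio_atTop (H : SigHyp σ lam K a b d) {ι : Type*} {l : Filter ι} {x y : ι → ℝ}
    (hx : Tendsto x l (𝓝[>] 0)) (hy : Tendsto y l (𝓝[>] 0))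
    (h : Tendsto (fun u => (σ (y u) / y u) / (σ (x u) / x u)) l (𝓝 0)) :
    Tendsto (fun u => y u / x u) l atTop := by
  have hyd : ∀ᶠ u in l, 0 < y u ∧ y u ≤ d :=
    ev_small H.d0 hy
  have hx0 : ∀ᶠ u in l, 0 < x u := (ev_small H.d0 hx).mono fun _ h => h.1
  rw [tendsto_atTop]
  intro Q
  set Q' := max Q 1
  have hQ' : 1 ≤ Q' := le_max_right _ _
  have hK := H.K0
  have hev := h.eventually_lt_const (show 0 < 1 / (K * (2 * Q')) by positivity)
  filter_upwards [hyd, hx0, hev] with u hu hxu hu2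
  by_contra hc
  push Not at hc
  have h1 := H.ratio_le (y := x u) hu.1 hu.2 hxu
  have hq : 0 < y u / x u := div_pos hu.1 hxu
  have hq' : y u / x u ≤ Q' := hc.le.trans (le_max_left _ _)
  rw [← inv_div (y u) (x u)] at h1
  have aux : ∀ e : ℝ, 0 < e → e < 1 → (y u / x u)⁻¹ ^ (e - 1) ≤ Q' := by
    intro e he he1
    rw [Real.inv_rpow hq.le, ← Real.rpow_neg hq.le]
    calc (y u / x u) ^ (-(e-1)) ≤ Q' ^ (-(e-1)) := Real.rpow_le_rpow hq.le hq' (by linarith)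
      _ ≤ Q' ^ (1:ℝ) := Real.rpow_le_rpow_of_exponent_le hQ' (by linarith)
      _ = Q' := Real.rpow_one _
  have h2 : (σ (x u) / x u) / (σ (y u) / y u) ≤ K * (2 * Q') := by
    refine h1.trans ?_
    gcongr
    have := aux a H.a0 (by linarith [H.al, H.l1])
    have := aux b H.b0 H.b1
    linarith
  have hp : 0 < (σ (y u) / y u) / (σ (x u) / x u) := by
    have g1 := H.pos _ hu.1
    have g2 := H.pos _ hxu
    have g3 := hu.1
    positivity
  rw [← inv_div, inv_le_comm₀ hp (by positivity)] at h2
  rw [one_div] at hu2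
  linarith

lemma ratio_tendsto (H : SigHyp σ lam K a b d) {ι : Type*} {l : Filter ι} {x y : ι → ℝ}
    (hx : Tendsto x l (𝓝[>] 0)) (hy : Tendsto y l (𝓝[>] 0)) {ρ : ℝ} (hρ : 0 < ρ)
    (h : Tendsto (fun u => (σ (y u) / y u) / (σ (x u) / x u)) l (𝓝 ρ)) :
    Tendsto (fun u => y u / x u) l (𝓝 (ρ ^ (1 / (lam - 1)))) := by
  have hyd : ∀ᶠ u in l, 0 < y u ∧ y u ≤ d :=
    ev_small H.d0 hy
  have hxd : ∀ᶠ u in l, 0 < x u ∧ x u ≤ d :=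
    ev_small H.d0 hx
  have hK := H.K0
  -- a general bound: if K (q^(a-1) + q^(b-1)) ≥ η > 0 then q is bounded
  have gen : ∀ η > 0, ∃ Q : ℝ, 0 < Q ∧ ∀ q, 0 < q → η ≤ K * (q ^ (a-1) + q ^ (b-1)) → q ≤ Q := by
    intro η hη
    have t1 : Tendsto (fun q : ℝ => K * (q ^ (a-1) + q ^ (b-1))) atTop (𝓝 (K * (0 + 0))) := by
      refine Tendsto.const_mul _ (Tendsto.add ?_ ?_)
      · have := tendsto_rpow_neg_atTop (y := 1 - a) (by linarith [H.al, H.l1])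
        simpa using this
      · have := tendsto_rpow_neg_atTop (y := 1 - b) (by linarith [H.b1])
        simpa using this
    have t2 := t1.eventually_lt_const (show K * (0+0) < η by simpa using hη)
    obtain ⟨Q, hQ⟩ := eventually_atTop.1 t2
    refine ⟨max Q 1, by positivity, fun q hq hqq => ?_⟩
    by_contra hc
    push Not at hc
    exact absurd (hQ q ((le_max_left _ _).trans hc.le)) (not_lt.2 hqq)
  obtain ⟨Q1, hQ1, hb1⟩ := gen (ρ/2) (by positivity)
  obtain ⟨Q2, hQ2, hb2⟩ := gen (1/(2*ρ)) (by positivity)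
  have hmem : ∀ᶠ u in l, y u / x u ∈ Set.Icc Q2⁻¹ Q1 := by
    filter_upwards [hyd, hxd, h.eventually_const_lt (show ρ/2 < ρ by linarith),
      h.eventually_lt_const (show ρ < 2 * ρ by linarith)] with u h1 h2 h3 h4
    have hq : 0 < y u / x u := div_pos h1.1 h2.1
    constructor
    · have e := H.ratio_le (y := x u) h1.1 h1.2 h2.1
      have : x u / y u ≤ Q2 := by
        refine hb2 _ (div_pos h2.1 h1.1) (le_trans ?_ e)
        rw [← inv_div (σ (y u) / y u), one_div]
        have hp : 0 < (σ (y u) / y u) / (σ (x u) / x u) := by linarith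
        exact (inv_le_inv₀ (by positivity) hp).2 h4.le
      rw [inv_le_comm₀ hQ2 hq, inv_div]; exact this
    · exact hb1 _ hq (h3.le.trans (H.ratio_le h2.1 h2.2 h1.1))
  rw [tendsto_iff_ultrafilter]
  intro U hU
  have hUm : ∀ᶠ u in (U : Filter ι), y u / x u ∈ Set.Icc Q2⁻¹ Q1 := hU hmem
  obtain ⟨q, hq, hqt⟩ := isCompact_Icc.ultrafilter_le_nhds (U.map fun u => y u / x u)
    (by rw [Filter.le_principal_iff]; exact hUm)
  have hqt' : Tendsto (fun u => y u / x u) (U : Filter ι) (𝓝 q) := hqt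
  have hq0 : 0 < q := lt_of_lt_of_le (by positivity) hq.1
  have t1 := H.tendsto_ratio (hx.mono_left hU) hqt'
  have t2 : Tendsto (fun u => σ |x u * (y u / x u)| / σ (x u)) (U : Filter ι) (𝓝 (ρ * q)) := by
    refine ((h.mono_left hU).mul hqt').congr' ?_
    filter_upwards [hU hyd, hU hxd] with u h1 h2
    have := H.pos _ h2.1
    have hx0 := h2.1
    have hy0 := h1.1
    rw [mul_div_cancel₀ _ hx0.ne', abs_of_pos hy0]
    field_simp
  have e := tendsto_nhds_unique t1 t2
  rw [abs_of_pos hq0] at e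
  have : q = ρ ^ (1 / (lam - 1)) := by
    have e2 : q ^ (lam - 1) = ρ := by
      rw [Real.rpow_sub_one hq0.ne', e]; field_simp
    rw [← e2, ← Real.rpow_mul hq0.le, mul_one_div_cancel (by linarith [H.l1]), Real.rpow_one]
  rw [← this]; exact hqt'

end SigHyp

open MeasureTheory ProbabilityTheory Filter Topology
namespace SigHyp
variable {σ : ℝ → ℝ} {lam K a b d : ℝ}

lemma cov_pos (H : SigHyp σ lam K a b d) {ι : Type*} {l : Filter ι} {x y : ι → ℝ}
    (hx : Tendsto x l (𝓝[>] 0)) (hy : Tendsto y l (𝓝[>] 0)) {ρ : ℝ} (hρ : 0 < ρ)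
    (h : Tendsto (fun u => (σ (y u) / y u) / (σ (x u) / x u)) l (𝓝 ρ)) (t s : ℝ) :
    Tendsto (fun u => covFromStd σ (x u * t) (y u * s) / (σ (x u) * σ (y u))) l
      (𝓝 (limCov lam ρ t s)) := by
  have hq := H.ratio_tendsto hx hy hρ h
  set A := ρ ^ (1 / (lam - 1)) with hA
  have hA0 : 0 < A := by positivity
  have t1 := H.tendsto_ratio hx (tendsto_const_nhds (x := t))
  have t2 := H.tendsto_ratio hx (hq.mul_const s)
  have t3 := H.tendsto_ratio hx ((hq.mul_const s).const_sub t)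
  have t4 := H.tendsto_ratio hx hq
  have hne : |A| ^ lam ≠ 0 := by
    have : 0 < |A| := by positivity
    positivity
  have t5 := ((((t1.pow 2).add (t2.pow 2)).sub (t3.pow 2)).div_const 2).div t4 hne
  have e : ((|t| ^ lam) ^ 2 + (|A * s| ^ lam) ^ 2 - (|t - A * s| ^ lam) ^ 2) / 2 / |A| ^ lam
      = limCov lam ρ t s := by
    have sq : ∀ z : ℝ, (|z| ^ lam) ^ 2 = |z| ^ (2 * lam) := fun z => by
      rw [← Real.rpow_natCast, ← Real.rpow_mul (abs_nonneg _)]; congr 1; push_cast; ring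
    rw [limCov, if_pos hρ, sq, sq, sq, div_div, abs_of_pos hA0, hA, ← Real.rpow_mul hρ.le]
  rw [e] at t5
  refine t5.congr' ?_
  filter_upwards [ev_small H.d0 hx, ev_small H.d0 hy] with u h1 h2
  have hx0 := h1.1
  have hy0 := h2.1
  have e1 : x u * (y u / x u * s) = y u * s := by field_simp
  have e2 : x u * (t - y u / x u * s) = x u * t - y u * s := by field_simp
  have e3 : x u * (y u / x u) = y u := by field_simp
  have s1 := H.pos _ hx0
  have s2 := H.pos _ hy0
  simp only [Pi.div_apply]
  rw [e1, e2, e3, abs_of_pos hy0, covFromStd]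
  field_simp

lemma telescope (H : SigHyp σ lam K a b d) (X h S : ℝ) (m : ℕ) (hm : 0 < m)
    (hS : ∀ k < m, σ |(k:ℝ) * h| ≤ S) :
    |σ |X| ^ 2 - σ |X - h| ^ 2| ≤
      (σ |X + ((m:ℝ) - 1) * h| ^ 2 + σ |X - h| ^ 2) / m + 2 * (σ |h| * S) := by
  have hm' : (0:ℝ) < m := by exact_mod_cast hm
  set G : ℕ → ℝ := fun k => σ |X + ((k:ℝ) - 1) * h| ^ 2 with hG
  have tel : ∑ k ∈ Finset.range m, (G (k+1) - G k) = G m - G 0 := Finset.sum_range_sub G m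
  set D := σ |X| ^ 2 - σ |X - h| ^ 2 with hD
  have h1 : |(m:ℝ) * D - (G m - G 0)| ≤ m * (2 * (σ |h| * S)) := by
    have : (m:ℝ) * D - (G m - G 0) = ∑ k ∈ Finset.range m, (D - (G (k+1) - G k)) := by
      rw [Finset.sum_sub_distrib, tel]; simp
    rw [this]
    refine (Finset.abs_sum_le_sum_abs _ _).trans ?_
    refine (Finset.sum_le_card_nsmul _ _ (2 * (σ |h| * S)) fun k hk => ?_).trans (by simp)
    have c := H.cs X h ((k:ℝ) * h)
    have e1 : G (k+1) = σ |X + (k:ℝ) * h| ^ 2 := by simp only [hG]; push_cast; ring_nf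
    have e2 : G k = σ |X + (k:ℝ) * h - h| ^ 2 := by simp only [hG]; ring_nf
    rw [e1, e2]
    refine c.trans ?_
    have := H.nonneg h
    gcongr
    exact hS k (Finset.mem_range.1 hk)
  have e0 : G 0 = σ |X - h| ^ 2 := by simp only [hG]; push_cast; ring_nf
  have g0 : 0 ≤ G 0 := by positivity
  have gm : 0 ≤ G m := by positivity
  rw [e0] at h1 g0
  rw [div_add' _ _ _ hm'.ne', le_div_iff₀ hm', ← abs_of_pos hm', ← abs_mul, abs_of_pos hm']
  have h2 : |D * m| ≤ |(m:ℝ) * D - (G m - σ |X - h| ^ 2)| + |G m - σ |X - h| ^ 2| := by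
    have := abs_add_le ((m:ℝ) * D - (G m - σ |X - h| ^ 2)) (G m - σ |X - h| ^ 2)
    rw [sub_add_cancel] at this
    rwa [mul_comm]
  have h3 : |G m - σ |X - h| ^ 2| ≤ G m + σ |X - h| ^ 2 := by
    rw [abs_le]; constructor <;> linarith
  have : G m = σ |X + ((m:ℝ) - 1) * h| ^ 2 := rfl
  rw [← this]
  linarith

lemma cov_zero (H : SigHyp σ lam K a b d) {ι : Type*} {l : Filter ι} {x y : ι → ℝ}
    (hx : Tendsto x l (𝓝[>] 0)) (hy : Tendsto y l (𝓝[>] 0)) 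
    (h : Tendsto (fun u => (σ (y u) / y u) / (σ (x u) / x u)) l (𝓝 0)) (t s : ℝ) :
    Tendsto (fun u => covFromStd σ (x u * t) (y u * s) / (σ (x u) * σ (y u))) l (𝓝 0) := by
  have hq := H.ratio_atTop hx hy h
  obtain ⟨e, he0, he⟩ := exists_between (show 0 < 1 - b by linarith [H.b1])
  have hab : a < b := H.al.trans H.lb
  set T := |s| + |t| with hT
  have hT0 : 0 ≤ T := by positivity
  set L := K * (T ^ a + T ^ b) with hL
  have hK := H.K0
  have hL0 : 0 ≤ L := by positivity
  set bound : ℝ → ℝ := fun q => (L ^ 2 * (K * (q ^ (-a) + q ^ (-b)))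
      + 2 * L ^ 2 * (K * (q ^ (-(1 - e - a)) + q ^ (-(1 - e - b))))
      + 2 * L * (K * ((q ^ (-e) * T) ^ a + (q ^ (-e) * T) ^ b))) with hbd
  have hbt : Tendsto bound atTop (𝓝 0) := by
    have p : ∀ c : ℝ, 0 < c → Tendsto (fun q : ℝ => q ^ (-c)) atTop (𝓝 0) :=
      fun c hc => tendsto_rpow_neg_atTop hc
    have p3 : ∀ c : ℝ, 0 < c → Tendsto (fun q : ℝ => (q ^ (-e) * T) ^ c) atTop (𝓝 0) := by
      intro c hc
      have := ((p e he0).mul_const T).rpow_const (p := c) (Or.inr hc.le)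
      simpa [Real.zero_rpow hc.ne'] using this
    have q1 := (((p a H.a0).add (p b H.b0)).const_mul K).const_mul (L ^ 2)
    have q2 := (((p (1 - e - a) (by linarith)).add (p (1 - e - b) (by linarith))).const_mul K).const_mul (2 * L ^ 2)
    have q3 := (((p3 a H.a0).add (p3 b H.b0)).const_mul K).const_mul (2 * L)
    have := (q1.add q2).add q3
    simpa [hbd] using this
  refine squeeze_zero_norm' ?_ (hbt.comp hq)
  filter_upwards [ev_small H.d0 hx, ev_small H.d0 hy, hq.eventually_ge_atTop 1] with u hu1 hu2 hq1
  obtain ⟨hx0, hxd⟩ := hu1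
  obtain ⟨hy0, hyd⟩ := hu2
  simp only [Function.comp]
  set X := x u
  set Y := y u
  set q := Y / X with hqdef
  have hq0 : 0 < q := by linarith
  have hYq : Y = q * X := by rw [hqdef]; field_simp
  have s1 := H.pos _ hx0
  have s2 := H.pos _ hy0
  -- monotone bound
  have mono : ∀ (z w : ℝ), 0 < w → w ≤ d → |z| ≤ T → σ |w * z| ≤ L * σ w := by
    intro z w hw hwd hz
    rw [abs_mul, abs_of_pos hw, mul_comm]
    refine (H.potter w |z| hw hwd (abs_nonneg _)).trans ?_
    have := H.pos _ hw
    have := H.a0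
    have := H.b0
    rw [hL]
    gcongr
  set m : ℕ := ⌈q ^ (1 - e)⌉₊ with hm
  have hqe : 0 < q ^ (1 - e) := by positivity
  have hm0 : 0 < m := Nat.ceil_pos.2 hqe
  have hmge : q ^ (1 - e) ≤ m := Nat.le_ceil _
  have hm' : (0:ℝ) < m := by exact_mod_cast hm0
  have hk : ∀ k < m, (k:ℝ) ≤ q ^ (1 - e) := fun k hk => (Nat.lt_ceil.1 hk).le
  have hqe1 : q ^ (1 - e) ≤ q := by
    conv_rhs => rw [← Real.rpow_one q]
    exact Real.rpow_le_rpow_of_exponent_le hq1 (by linarith)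
  have hqe2 : q ^ (1 - e) = q * q ^ (-e) := by
    rw [sub_eq_add_neg, Real.rpow_add hq0, Real.rpow_one]
  set S := K * ((q ^ (-e) * T) ^ a + (q ^ (-e) * T) ^ b) * σ Y with hSdef
  have hS : ∀ k < m, σ |(k:ℝ) * (X * t)| ≤ S := by
    intro k hkm
    have e1 : |(k:ℝ) * (X * t)| = (k * |t| / q) * Y := by
      rw [abs_mul, abs_mul, abs_of_pos hx0, Nat.abs_cast, hYq]; field_simp
    rw [e1]
    refine (H.potter Y _ hy0 hyd (by positivity)).trans ?_
    have hle : (k:ℝ) * |t| / q ≤ q ^ (-e) * T := by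
      rw [div_le_iff₀ hq0]
      have := hk k hkm
      rw [hqe2] at this
      calc (k:ℝ) * |t| ≤ (q * q ^ (-e)) * T := by
            gcongr
            linarith [abs_nonneg s]
        _ = _ := by ring
    have := H.a0
    have := H.b0
    rw [hSdef]
    gcongr
  have tele := H.telescope (Y * s) (X * t) S m hm0 hS
  have b1 : σ |X * t| ≤ L * σ X := mono t X hx0 hxd (by linarith [abs_nonneg s])
  have b2 : σ |Y * s + ((m:ℝ) - 1) * (X * t)| ≤ L * σ Y := by
    have e1 : Y * s + ((m:ℝ) - 1) * (X * t) = Y * (s + ((m:ℝ) - 1) / q * t) := by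
      rw [hYq]; field_simp
    rw [e1]
    apply mono _ _ hy0 hyd
    have hm1 : ((m:ℝ) - 1) / q ≤ 1 := by
      rw [div_le_one hq0]
      have := Nat.ceil_lt_add_one hqe.le
      rw [← hm] at this; linarith
    have hm2 : 0 ≤ ((m:ℝ) - 1) / q := by
      have : (1:ℝ) ≤ m := by exact_mod_cast hm0
      apply div_nonneg _ hq0.le; linarith
    refine (abs_add_le _ _).trans ?_
    rw [abs_mul, abs_of_nonneg hm2]
    have := abs_nonneg t
    nlinarith
  have b3 : σ |Y * s - X * t| ≤ L * σ Y := by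
    have e1 : Y * s - X * t = Y * (s - t / q) := by
      rw [hYq]; field_simp
    rw [e1]
    apply mono _ _ hy0 hyd
    refine (abs_sub _ _).trans ?_
    rw [abs_div, abs_of_pos hq0]
    have : |t| / q ≤ |t| := div_le_self (abs_nonneg _) hq1
    linarith
  have r1 : σ X ≤ K * (q ^ (-a) + q ^ (-b)) * σ Y := by
    have := H.potter Y (1/q) hy0 hyd (by positivity)
    rw [one_div, Real.inv_rpow hq0.le, Real.inv_rpow hq0.le, ← Real.rpow_neg hq0.le, ← Real.rpow_neg hq0.le] at this
    have e1 : q⁻¹ * Y = X := by rw [hYq]; field_simp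
    rwa [e1] at this
  have r2 : σ Y / m ≤ K * (q ^ (-(1 - e - a)) + q ^ (-(1 - e - b))) * σ X := by
    have h1 := H.potter X q hx0 hxd hq0.le
    rw [← hYq] at h1
    rw [div_le_iff₀ hm']
    have e1 : ∀ c, q ^ c = q ^ (-(1 - e - c)) * q ^ (1 - e) := by
      intro c; rw [← Real.rpow_add hq0]; congr 1; ring
    rw [e1 a, e1 b] at h1
    refine h1.trans ?_
    rw [← add_mul]
    calc K * ((q ^ (-(1 - e - a)) + q ^ (-(1 - e - b))) * q ^ (1 - e)) * σ X 
        ≤ K * ((q ^ (-(1 - e - a)) + q ^ (-(1 - e - b))) * m) * σ X := by gcongr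
      _ = _ := by ring
  have n1 := H.nonneg (X * t)
  have n2 := H.nonneg (Y * s + ((m:ℝ) - 1) * (X * t))
  have n3 := H.nonneg (Y * s - X * t)
  have hS0 : 0 ≤ S := by positivity
  have sq1 : σ |X * t| ^ 2 ≤ (L * σ X) ^ 2 := by gcongr
  have sq2 : σ |Y * s + ((m:ℝ) - 1) * (X * t)| ^ 2 ≤ (L * σ Y) ^ 2 := by gcongr
  have sq3 : σ |Y * s - X * t| ^ 2 ≤ (L * σ Y) ^ 2 := by gcongr
  have tele2 : |σ |Y * s| ^ 2 - σ |Y * s - X * t| ^ 2| ≤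
      ((L * σ Y) ^ 2 + (L * σ Y) ^ 2) / m + 2 * (L * σ X * S) := by
    refine tele.trans ?_
    gcongr
  have key1 : (L * σ X) ^ 2 ≤ L ^ 2 * (K * (q ^ (-a) + q ^ (-b))) * (σ X * σ Y) := by
    calc (L * σ X) ^ 2 = L ^ 2 * σ X * σ X := by ring
      _ ≤ L ^ 2 * σ X * (K * (q ^ (-a) + q ^ (-b)) * σ Y) := by gcongr
      _ = _ := by ring
  have key2 : ((L * σ Y) ^ 2 + (L * σ Y) ^ 2) / m ≤
      2 * L ^ 2 * (K * (q ^ (-(1 - e - a)) + q ^ (-(1 - e - b)))) * (σ X * σ Y) := by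
    calc ((L * σ Y) ^ 2 + (L * σ Y) ^ 2) / m = 2 * L ^ 2 * σ Y * (σ Y / m) := by ring
      _ ≤ 2 * L ^ 2 * σ Y * (K * (q ^ (-(1 - e - a)) + q ^ (-(1 - e - b))) * σ X) := by gcongr
      _ = _ := by ring
  have key3 : 2 * (L * σ X * S) = 
      2 * L * (K * ((q ^ (-e) * T) ^ a + (q ^ (-e) * T) ^ b)) * (σ X * σ Y) := by
    rw [hSdef]; ring
  rw [Real.norm_eq_abs, abs_div, abs_of_pos (mul_pos s1 s2), div_le_iff₀ (mul_pos s1 s2), covFromStd]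
  have e5 : σ |X * t - Y * s| = σ |Y * s - X * t| := by rw [abs_sub_comm]
  rw [e5]
  have hfin : bound q * (σ X * σ Y) = L ^ 2 * (K * (q ^ (-a) + q ^ (-b))) * (σ X * σ Y)
      + 2 * L ^ 2 * (K * (q ^ (-(1 - e - a)) + q ^ (-(1 - e - b)))) * (σ X * σ Y)
      + 2 * L * (K * ((q ^ (-e) * T) ^ a + (q ^ (-e) * T) ^ b)) * (σ X * σ Y) := by
    simp only [hbd]; ring
  rw [hfin]
  have ab := abs_le.1 tele2
  have sqn : 0 ≤ σ |X * t| ^ 2 := by positivity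
  rw [abs_le]
  constructor <;> linarith

lemma cov_tendsto (H : SigHyp σ lam K a b d) {ι : Type*} {l : Filter ι} {x y : ι → ℝ}
    (hx : Tendsto x l (𝓝[>] 0)) (hy : Tendsto y l (𝓝[>] 0)) {ρ : ℝ} (hρ : 0 ≤ ρ)
    (h : Tendsto (fun u => (σ (y u) / y u) / (σ (x u) / x u)) l (𝓝 ρ)) (t s : ℝ) :
    Tendsto (fun u => covFromStd σ (x u * t) (y u * s) / (σ (x u) * σ (y u))) l
      (𝓝 (limCov lam ρ t s)) := by
  rcases hρ.eq_or_lt with rfl | hρ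
  · have := H.cov_zero hx hy h t s
    simpa [limCov] using this
  · exact H.cov_pos hx hy hρ h t s

end SigHyp

open MeasureTheory ProbabilityTheory Filter Topology

section
variable {Ω : Type*} [MeasurableSpace Ω] {P : Measure Ω} [IsProbabilityMeasure P]

lemma incr_law {σ : ℝ → ℝ} (hσ0 : σ 0 = 0) {J : ℝ → Ω → ℝ}
    (hJ : IsCenteredGaussian1 P J (covFromStd σ)) (t s : ℝ) :
    P.map (fun ω => J t ω - J s ω) = gaussianReal 0 (σ |t - s| ^ 2).toNNReal := by
  have h := hJ.2 2 ![t, s] ![1, -1]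
  simp only [Fin.sum_univ_two, Matrix.cons_val_zero, Matrix.cons_val_one, covFromStd, sub_self,
    abs_zero, hσ0] at h
  convert h using 2
  · ext ω; ring
  · congr 1; rw [abs_sub_comm s t]; ring

lemma single_law {σ : ℝ → ℝ} (hσ0 : σ 0 = 0) {J : ℝ → Ω → ℝ}
    (hJ : IsCenteredGaussian1 P J (covFromStd σ)) (t : ℝ) :
    P.map (J t) = gaussianReal 0 (σ |t| ^ 2).toNNReal := by
  have h := hJ.2 1 ![t] ![1]
  simp only [Fin.sum_univ_one, Matrix.cons_val_zero, covFromStd, sub_self,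
    abs_zero, hσ0] at h
  convert h using 2
  · ext ω; ring
  · congr 1; ring

lemma memLp_of_gauss {X : Ω → ℝ} (hX : Measurable X) {v : NNReal}
    (h : P.map X = gaussianReal 0 v) (p : NNReal) : MemLp X p P := by
  have := memLp_id_gaussianReal (μ := 0) (v := v) p
  rw [← h, memLp_map_measure_iff (by fun_prop) hX.aemeasurable] at this
  exact this

lemma sq_of_gauss {X : Ω → ℝ} (hX : Measurable X) {v : NNReal}
    (h : P.map X = gaussianReal 0 v) : ∫ ω, X ω * X ω ∂P = v := by
  have h1 : ∫ x, x * x ∂(P.map X) = ∫ ω, X ω * X ω ∂P :=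
    integral_map hX.aemeasurable (by fun_prop)
  rw [← h1, h]
  have h2 := variance_fun_id_gaussianReal (μ := 0) (v := v)
  rw [variance_of_integral_eq_zero (by fun_prop) (by simp)] at h2
  rw [← h2]
  congr 1; ext x; simp [sq]

lemma sig_embed {σ : ℝ → ℝ} (hσ0 : σ 0 = 0) (hσpos : ∀ t > (0:ℝ), 0 < σ t) {J : ℝ → Ω → ℝ}
    (hJ : IsCenteredGaussian1 P J (covFromStd σ)) :
    ∃ j : ℝ → Lp ℝ 2 P, ∀ t s, ‖j t - j s‖ = σ |t - s| := by
  have hm : ∀ t, MemLp (J t) 2 P := fun t =>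
    by simpa using memLp_of_gauss (hJ.1 t) (single_law hσ0 hJ t) 2
  refine ⟨fun t => (hm t).toLp, fun t s => ?_⟩
  have hn : 0 ≤ σ |t - s| := by
    rcases (abs_nonneg (t - s)).eq_or_lt with h | h
    · rw [← h, hσ0]
    · exact (hσpos _ h).le
  have h2 : ‖(hm t).toLp - (hm s).toLp‖ ^ 2 = σ |t - s| ^ 2 := by
    rw [← MemLp.toLp_sub (hm t) (hm s), ← real_inner_self_eq_norm_sq, L2.inner_def]
    have : ∫ ω, (J t ω - J s ω) * (J t ω - J s ω) ∂P = σ |t - s| ^ 2 := by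
      rw [sq_of_gauss (X := fun ω => J t ω - J s ω) ((hJ.1 t).sub (hJ.1 s)) (incr_law hσ0 hJ t s)]
      exact Real.coe_toNNReal _ (by positivity)
    rw [← this]
    apply integral_congr_ae
    filter_upwards [((hm t).sub (hm s)).coeFn_toLp] with ω hω
    rw [hω]; simp [sq]
  exact (sq_eq_sq₀ (norm_nonneg _) hn).1 h2

lemma sig_sub_cs {σ : ℝ → ℝ} (hσ0 : σ 0 = 0) (hσpos : ∀ t > (0:ℝ), 0 < σ t) {J : ℝ → Ω → ℝ}
    (hJ : IsCenteredGaussian1 P J (covFromStd σ)) :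
    (∀ x y : ℝ, σ |x + y| ≤ σ |x| + σ |y|) ∧
    ∀ x h w : ℝ, |(σ |x| ^ 2 - σ |x - h| ^ 2) - (σ |x + w| ^ 2 - σ |x + w - h| ^ 2)|
    ≤ 2 * (σ |h| * σ |w|) := by
  obtain ⟨j, hj⟩ := sig_embed hσ0 hσpos hJ
  constructor
  · intro x y
    have h1 := hj (x + y) 0
    have h2 := hj (x + y) y
    have h3 := hj y 0
    simp only [sub_zero, add_sub_cancel_right] at h1 h2 h3
    rw [← h1, ← h2, ← h3]
    calc ‖j (x+y) - j 0‖ = ‖(j (x+y) - j y) + (j y - j 0)‖ := by congr 1; abel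
      _ ≤ _ := norm_add_le _ _
  · intro x h w
    have h1 := hj x 0
    have h2 := hj x h
    have h3 := hj (x + w) 0
    have h4 := hj (x + w) h
    have h5 := hj h 0
    have h6 := hj (x + w) x
    simp only [sub_zero, add_sub_cancel_left] at h1 h3 h5 h6
    rw [← h1, ← h2, ← h3, ← h4, ← h5, ← h6]
    have e : (‖j x - j 0‖ ^ 2 - ‖j x - j h‖ ^ 2) - (‖j (x+w) - j 0‖ ^ 2 - ‖j (x+w) - j h‖ ^ 2)
        = -2 * inner ℝ (j h - j 0) (j (x+w) - j x) := by
      have i1 : ‖j x - j h‖ ^ 2 = ‖j x - j 0‖ ^ 2 - 2 * inner ℝ (j x - j 0) (j h - j 0) + ‖j h - j 0‖ ^ 2 := by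
        rw [← norm_sub_sq_real]; congr 2; abel
      have i2 : ‖j (x+w) - j h‖ ^ 2 = ‖j (x+w) - j 0‖ ^ 2 - 2 * inner ℝ (j (x+w) - j 0) (j h - j 0) + ‖j h - j 0‖ ^ 2 := by
        rw [← norm_sub_sq_real]; congr 2; abel
      have i3 : inner ℝ (j h - j 0) (j (x+w) - j x) = inner ℝ (j (x+w) - j 0) (j h - j 0) - inner ℝ (j x - j 0) (j h - j 0) := by
        rw [← inner_sub_left, real_inner_comm]; congr 1; abel
      rw [i1, i2, i3]; ring
    rw [e, abs_mul]
    have := abs_real_inner_le_norm (j h - j 0) (j (x+w) - j x)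
    norm_num
    exact this

lemma sigHyp_of {σ : ℝ → ℝ} (hσcont : ContinuousOn σ (Set.Ici 0)) (hσ0 : σ 0 = 0)
    (hσpos : ∀ t > (0:ℝ), 0 < σ t) {J : ℝ → Ω → ℝ}
    (hJ : IsCenteredGaussian1 P J (covFromStd σ))
    {lam : ℝ} (hlam : lam ∈ Set.Ioo (0:ℝ) 1)
    (hL1 : ∀ t > (0:ℝ), Tendsto (fun x => σ (t * x) / σ x) (𝓝[>] 0) (𝓝 (t ^ lam)))
    {t₀ β C : ℝ} (ht₀ : 0 < t₀) (hβ : β ∈ Set.Ioo (0:ℝ) 1) (hC : 0 < C)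
    (hL2 : ∀ t > t₀, σ t ≤ C * t ^ β) :
    ∃ K a b d : ℝ, SigHyp σ lam K a b d := by
  obtain ⟨h1, h2⟩ := sig_sub_cs hσ0 hσpos hJ
  obtain ⟨K, a, b, d, q1, q2, q3, q4, q5, q6, q7⟩ := rv_potter hσcont hσ0 hσpos
    (fun x y hx hy => by
      have := h1 x y
      rwa [abs_of_nonneg hx, abs_of_nonneg hy, abs_of_nonneg (by positivity)] at this)
    hlam hL1 ht₀ hβ hC hL2
  exact ⟨K, a, b, d, hσ0, hσpos, h1, h2, hlam.1, hlam.2, hL1, q1, q2, q3, q4, q5, q6, q7⟩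

/-- `δ x → 0+`. -/
lemma delta_tendsto {σ : ℝ → ℝ} (hσcont : ContinuousOn σ (Set.Ici 0))
    {t₀ β C : ℝ} (ht₀ : 0 < t₀) (hβ : β ∈ Set.Ioo (0:ℝ) 1) (hC : 0 < C)
    (hL2 : ∀ t > t₀, σ t ≤ C * t ^ β)
    {δ : ℝ → ℝ} (hδ : ∀ᶠ x in atTop, 0 < δ x ∧ x * δ x = σ (δ x)) :
    Tendsto δ atTop (𝓝[>] 0) := by
  rw [tendsto_nhdsWithin_iff]
  refine ⟨?_, hδ.mono fun x h => h.1⟩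
  rw [Metric.tendsto_nhds]
  intro ε hε
  obtain ⟨M, hM⟩ := ((isCompact_Icc (a := ε) (b := max ε t₀)).bddAbove_image
    (hσcont.mono (fun z hz => Set.mem_Ici.2 (hε.le.trans hz.1))))
  have hM' : ∀ y ∈ Set.Icc ε (max ε t₀), σ y ≤ M := fun y hy => hM (Set.mem_image_of_mem _ hy)
  filter_upwards [hδ, eventually_gt_atTop (|M| / ε), eventually_gt_atTop (C * t₀ ^ (β - 1)),
    eventually_gt_atTop 0] with x hx h1 h2 h0
  rw [Real.dist_eq, sub_zero, abs_of_pos hx.1]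
  by_contra hc
  push Not at hc
  have hd := hx.1
  by_cases hle : δ x ≤ t₀
  · have h3 := hM' _ ⟨hc, hle.trans (le_max_right _ _)⟩
    rw [div_lt_iff₀ hε] at h1
    have : x * ε ≤ x * δ x := by gcongr
    linarith [le_abs_self M, hx.2]
  · push Not at hle
    have h3 := hL2 _ hle
    rw [← hx.2] at h3
    have e : δ x ^ β = δ x ^ (β - 1) * δ x := by
      rw [Real.rpow_sub_one hd.ne']; field_simp
    rw [e, ← mul_assoc] at h3
    have h4 := le_of_mul_le_mul_right h3 hd
    have h5 : δ x ^ (β - 1) ≤ t₀ ^ (β - 1) :=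
      Real.rpow_le_rpow_of_nonpos ht₀ hle.le (by linarith [hβ.2])
    have : C * δ x ^ (β - 1) ≤ C * t₀ ^ (β - 1) := by gcongr
    linarith
end

open MeasureTheory ProbabilityTheory Filter Topology

/-- Chaining: distance of `f t` to its dyadic approximation. -/
lemma chain_dyadic {f : ℝ → ℝ} (hf : Continuous f) {G q : ℝ} (hG : 0 ≤ G) (hq0 : 0 ≤ q)
    (hq1 : q < 1) {N : ℕ}
    (h : ∀ (m : ℕ) (k : ℤ), |(k:ℝ)| ≤ N * 2 ^ m →
      |f ((k + 1) / 2 ^ m) - f (k / 2 ^ m)| ≤ G * q ^ m)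
    {t : ℝ} (ht : |t| + 1 ≤ N) (m : ℕ) :
    |f (⌊2 ^ m * t⌋ / 2 ^ m) - f t| ≤ G * q ^ m / (1 - q) := by
  have hlim : Tendsto (fun m : ℕ => (⌊2 ^ m * t⌋ : ℝ) / 2 ^ m) atTop (𝓝 t) := by
    have h0 : Tendsto (fun m : ℕ => (1/2:ℝ) ^ m) atTop (𝓝 0) :=
      tendsto_pow_atTop_nhds_zero_of_lt_one (by norm_num) (by norm_num)
    have h1 : Tendsto (fun m : ℕ => t - (1/2:ℝ) ^ m) atTop (𝓝 t) := by
      simpa using tendsto_const_nhds.sub h0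
    refine tendsto_of_tendsto_of_tendsto_of_le_of_le h1 tendsto_const_nhds ?_ ?_
    · intro m
      have hp : (0:ℝ) < 2 ^ m := by positivity
      show t - (1/2:ℝ) ^ m ≤ _
      rw [le_div_iff₀ hp, sub_mul, ← mul_pow]
      have := Int.sub_one_lt_floor (2 ^ m * t)
      norm_num
      linarith
    · intro m
      have hp : (0:ℝ) < 2 ^ m := by positivity
      show _ ≤ t
      rw [div_le_iff₀ hp]
      have := Int.floor_le (2 ^ m * t)
      linarith
  have hlim' := (hf.tendsto t).comp hlim
  have := dist_le_of_le_geometric_of_tendsto (f := fun m : ℕ => f ((⌊2 ^ m * t⌋ : ℝ) / 2 ^ m))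
    q G hq1 (fun m => ?_) hlim' m
  · simpa [Real.dist_eq] using this
  · have hp : (0:ℝ) < 2 ^ m := by positivity
    set j := ⌊2 ^ m * t⌋ with hj
    have hj1 := Int.floor_le (2 ^ m * t)
    have hj2 := Int.lt_floor_add_one (2 ^ m * t)
    rw [← hj] at hj1 hj2
    have e2 : (2:ℝ) ^ (m+1) * t = 2 * (2 ^ m * t) := by ring
    have hk1 : 2 * j ≤ ⌊2 ^ (m+1) * t⌋ := by
      rw [Int.le_floor]; push_cast; rw [e2]; linarith
    have hk2 : ⌊2 ^ (m+1) * t⌋ < 2 * j + 2 := by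
      rw [Int.floor_lt]; push_cast; rw [e2]; linarith
    have hb : |((2 * j : ℤ):ℝ)| ≤ N * 2 ^ (m+1) := by
      have : |(j:ℝ)| ≤ N * 2 ^ m := by
        have a1 : |(2:ℝ) ^ m * t| ≤ 2 ^ m * |t| := by rw [abs_mul, abs_of_pos hp]
        have a2 := abs_le.1 a1
        have a3 : (1:ℝ) ≤ 2 ^ m := one_le_pow₀ (by norm_num)
        have a4 : 2 ^ m * (|t| + 1) ≤ (2:ℝ) ^ m * N := by gcongr
        rw [abs_le]; constructor <;> nlinarith
      push_cast
      rw [abs_mul, pow_succ]; norm_num; linarith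
    have hh := h (m+1) (2 * j) hb
    have e3 : ((2 * j : ℤ) : ℝ) / 2 ^ (m+1) = j / 2 ^ m := by
      push_cast; rw [pow_succ]; field_simp
    have hqq : G * q ^ (m+1) ≤ G * q ^ m := by
      apply mul_le_mul_of_nonneg_left _ hG
      exact pow_le_pow_of_le_one hq0 hq1.le (Nat.le_succ m)
    rw [Real.dist_eq]
    rcases (show ⌊2 ^ (m+1) * t⌋ = 2 * j ∨ ⌊2 ^ (m+1) * t⌋ = 2 * j + 1 by omega) with h' | h'
    · show |f (j / 2 ^ m) - f ((⌊2 ^ (m+1) * t⌋ : ℝ) / 2 ^ (m+1))| ≤ _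
      rw [h', e3]; simp; positivity
    · show |f (j / 2 ^ m) - f ((⌊2 ^ (m+1) * t⌋ : ℝ) / 2 ^ (m+1))| ≤ _
      rw [h', abs_sub_comm, ← e3]
      refine le_trans ?_ hqq
      rw [Int.cast_add, Int.cast_one]
      exact hh

lemma chain_modulus {f : ℝ → ℝ} (hf : Continuous f) {G q : ℝ} (hG : 0 ≤ G) (hq0 : 0 ≤ q)
    (hq1 : q < 1) {N : ℕ}
    (h : ∀ (m : ℕ) (k : ℤ), |(k:ℝ)| ≤ N * 2 ^ m →
      |f ((k + 1) / 2 ^ m) - f (k / 2 ^ m)| ≤ G * q ^ m)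
    {s t : ℝ} (hs : |s| + 1 ≤ N) (ht : |t| + 1 ≤ N) (m : ℕ) (hst : |t - s| ≤ (1/2) ^ m) :
    |f t - f s| ≤ 3 * G / (1 - q) * q ^ m := by
  wlog hle : s ≤ t generalizing s t
  · rw [abs_sub_comm]
    exact this ht hs (by rwa [abs_sub_comm]) (le_of_not_ge hle)
  have h1 := chain_dyadic hf hG hq0 hq1 h hs m
  have h2 := chain_dyadic hf hG hq0 hq1 h ht m
  have hp : (0:ℝ) < 2 ^ m := by positivity
  have h3 : |f (⌊2 ^ m * t⌋ / 2 ^ m) - f (⌊2 ^ m * s⌋ / 2 ^ m)| ≤ G * q ^ m := by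
    set j := ⌊2 ^ m * s⌋ with hj
    have hj1 := Int.floor_le (2 ^ m * s)
    have hj2 := Int.lt_floor_add_one (2 ^ m * s)
    rw [← hj] at hj1 hj2
    have hms : 2 ^ m * s ≤ 2 ^ m * t := by gcongr
    have hts : 2 ^ m * t ≤ 2 ^ m * s + 1 := by
      rw [abs_of_nonneg (by linarith)] at hst
      have : 2 ^ m * (t - s) ≤ 2 ^ m * (1/2) ^ m := by gcongr
      rw [← mul_pow] at this; norm_num at this; linarith
    have hk1 : j ≤ ⌊2 ^ m * t⌋ := by rw [Int.le_floor]; linarith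
    have hk2 : ⌊2 ^ m * t⌋ < j + 2 := by rw [Int.floor_lt]; push_cast; linarith
    have hb : |(j:ℝ)| ≤ N * 2 ^ m := by
        have a1 : |(2:ℝ) ^ m * s| ≤ 2 ^ m * |s| := by rw [abs_mul, abs_of_pos hp]
        have a2 := abs_le.1 a1
        have a3 : (1:ℝ) ≤ 2 ^ m := one_le_pow₀ (by norm_num)
        have a4 : 2 ^ m * (|s| + 1) ≤ (2:ℝ) ^ m * N := by gcongr
        rw [abs_le]; constructor <;> nlinarith
    rcases (show ⌊2 ^ m * t⌋ = j ∨ ⌊2 ^ m * t⌋ = j + 1 by omega) with h' | h'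
    · rw [h']; simp; positivity
    · rw [h']
      have := h m j hb
      push_cast; exact this
  have h1q : 0 < 1 - q := by linarith
  have h4 : G * q ^ m ≤ G * q ^ m / (1 - q) := by
    rw [le_div_iff₀ h1q]
    have : 0 ≤ G * q ^ m := by positivity
    nlinarith
  have e : 3 * G / (1 - q) * q ^ m = 3 * (G * q ^ m / (1 - q)) := by ring
  rw [e]
  calc |f t - f s| = |-(f (⌊2 ^ m * t⌋ / 2 ^ m) - f t)
          + (f (⌊2 ^ m * t⌋ / 2 ^ m) - f (⌊2 ^ m * s⌋ / 2 ^ m))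
          + (f (⌊2 ^ m * s⌋ / 2 ^ m) - f s)| := by congr 1; ring
    _ ≤ |-(f (⌊2 ^ m * t⌋ / 2 ^ m) - f t)
          + (f (⌊2 ^ m * t⌋ / 2 ^ m) - f (⌊2 ^ m * s⌋ / 2 ^ m))|
          + |f (⌊2 ^ m * s⌋ / 2 ^ m) - f s| := abs_add_le _ _
    _ ≤ |-(f (⌊2 ^ m * t⌋ / 2 ^ m) - f t)|
          + |f (⌊2 ^ m * t⌋ / 2 ^ m) - f (⌊2 ^ m * s⌋ / 2 ^ m)|
          + |f (⌊2 ^ m * s⌋ / 2 ^ m) - f s| := by gcongr; exact abs_add_le _ _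
    _ ≤ _ := by rw [abs_neg]; linarith

/-- The compact sets of functions. -/
def KS (n : ℕ) (A b q : ℝ) : Set (ℝ → Fin n → ℝ) :=
  {f | ∀ i, (∀ N m : ℕ, ∀ s t : ℝ, |s| ≤ N → |t| ≤ N → |t - s| ≤ (1/2) ^ m →
      |f t i - f s i| ≤ A * (N + 2) * q ^ m) ∧ ∀ t, |f t i| ≤ A * (3 + |t|) ^ b}

lemma KS_compact (n : ℕ) (A b q : ℝ) : IsCompact (KS n A b q) := by
  have hc : IsClosed (KS n A b q) := by
    have : KS n A b q = ⋂ i, ((⋂ (N : ℕ) (m : ℕ) (s : ℝ) (t : ℝ) (_ : |s| ≤ N) (_ : |t| ≤ N)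
      (_ : |t - s| ≤ (1/2) ^ m), {f | |f t i - f s i| ≤ A * (N + 2) * q ^ m}) ∩
      ⋂ t : ℝ, {f | |f t i| ≤ A * (3 + |t|) ^ b}) := by
      ext f; simp [KS]
    rw [this]
    refine isClosed_iInter fun i => IsClosed.inter ?_ ?_
    · refine isClosed_iInter fun N => isClosed_iInter fun m => isClosed_iInter fun s =>
        isClosed_iInter fun t => isClosed_iInter fun _ => isClosed_iInter fun _ =>
        isClosed_iInter fun _ => ?_
      exact isClosed_le (by fun_prop) (by fun_prop)
    · refine isClosed_iInter fun t => isClosed_le (by fun_prop) (by fun_prop)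
  have hk : IsCompact (Set.pi Set.univ (fun t : ℝ => Set.pi Set.univ (fun _ : Fin n =>
      Set.Icc (-(A * (3 + |t|) ^ b)) (A * (3 + |t|) ^ b)))) :=
    isCompact_univ_pi fun t => isCompact_univ_pi fun i => isCompact_Icc
  refine hk.of_isClosed_subset hc ?_
  intro f hf t _ i _
  exact abs_le.1 ((hf i).2 t)

/-- Dyadic bounds imply membership in the compact set. -/
lemma mem_KS {n : ℕ} {a b A : ℝ} (ha : 0 < a) (hab : a / 4 ≤ b) (hb : b ≤ 1) (hA : 0 ≤ A)
    {f : ℝ → Fin n → ℝ} (hf : ∀ i, Continuous fun t => f t i)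
    (h1 : ∀ i (m : ℕ) (k : ℤ), |f ((k + 1) / 2 ^ m) i - f (k / 2 ^ m) i|
      ≤ A * ((2:ℝ) ^ (-(a / 2) * m) * (1 + |(k:ℝ)|) ^ (a / 4)))
    (h2 : ∀ i (k : ℤ), |f k i| ≤ A * (1 + |(k:ℝ)|) ^ b) :
    f ∈ KS n (3 * A / (1 - (2:ℝ) ^ (-(a/4)))) b ((2:ℝ) ^ (-(a/4))) := by
  set q := (2:ℝ) ^ (-(a/4)) with hq
  have hq0 : 0 < q := by positivity
  have hq1 : q < 1 := Real.rpow_lt_one_of_one_lt_of_neg (by norm_num) (by linarith)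
  have h1q : 0 < 1 - q := by linarith
  have key : ∀ i (N m : ℕ) (k : ℤ), |(k:ℝ)| ≤ N * 2 ^ m →
      |f ((k + 1) / 2 ^ m) i - f (k / 2 ^ m) i| ≤ (A * (N + 1) ^ (a/4)) * q ^ m := by
    intro i N m k hk
    refine (h1 i m k).trans ?_
    rw [mul_assoc]
    refine mul_le_mul_of_nonneg_left ?_ hA
    have hp : (1:ℝ) ≤ 2 ^ m := one_le_pow₀ (by norm_num)
    have : (1 + |(k:ℝ)|) ^ (a/4) ≤ ((N + 1) * 2 ^ m) ^ (a/4) := by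
      apply Real.rpow_le_rpow (by positivity) _ (by positivity)
      nlinarith
    calc (2:ℝ) ^ (-(a / 2) * m) * (1 + |(k:ℝ)|) ^ (a / 4)
        ≤ (2:ℝ) ^ (-(a / 2) * m) * ((N + 1) * 2 ^ m) ^ (a/4) := by gcongr
      _ = (N + 1) ^ (a/4) * q ^ m := by
        rw [Real.mul_rpow (by positivity) (by positivity), ← Real.rpow_natCast 2 m,
          ← Real.rpow_mul (by norm_num), hq, ← Real.rpow_natCast (2 ^ (-(a/4))) m,
          ← Real.rpow_mul (by norm_num)]
        rw [mul_left_comm, ← Real.rpow_add (by norm_num)]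
        congr 2; ring
  intro i
  refine ⟨fun N m s t hs ht hst => ?_, fun t => ?_⟩
  · have := chain_modulus (hf i) (G := A * ((N + 1 : ℕ) + 1) ^ (a/4)) (by positivity) hq0.le hq1
      (N := N + 1) (key i (N+1)) (s := s) (t := t) (by push_cast; linarith)
      (by push_cast; linarith) m hst
    refine this.trans ?_
    have h3 : (((N + 1 : ℕ) : ℝ) + 1) ^ (a/4) ≤ N + 2 := by
      have : (((N + 1 : ℕ) : ℝ) + 1) = N + 2 := by push_cast; ring
      rw [this]
      calc ((N:ℝ) + 2) ^ (a/4) ≤ ((N:ℝ) + 2) ^ (1:ℝ) :=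
            Real.rpow_le_rpow_of_exponent_le (by linarith [(Nat.cast_nonneg N : (0:ℝ) ≤ N)])
              (by linarith)
        _ = _ := Real.rpow_one _
    calc 3 * (A * ((N + 1 : ℕ) + 1) ^ (a/4)) / (1 - q) * q ^ m
        ≤ 3 * (A * (N + 2)) / (1 - q) * q ^ m := by gcongr
      _ = _ := by ring
  · set N := ⌈|t|⌉₊ + 1 with hN
    have hN1 : |t| + 1 ≤ N := by rw [hN]; push_cast; linarith [Nat.le_ceil |t|]
    have hN2 : (N:ℝ) + 1 ≤ 3 + |t| := by
      rw [hN]; push_cast; linarith [Nat.ceil_lt_add_one (abs_nonneg t)]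
    have := chain_dyadic (hf i) (G := A * (N + 1) ^ (a/4)) (by positivity) hq0.le hq1
      (key i N) hN1 0
    simp only [pow_zero, one_mul, div_one, mul_one] at this
    have h3 := h2 i ⌊t⌋
    have h4 : (1:ℝ) + |(⌊t⌋:ℝ)| ≤ 3 + |t| := by
      have a1 := Int.floor_le t
      have a2 := Int.lt_floor_add_one t
      have : |(⌊t⌋:ℝ)| ≤ |t| + 1 := by
        rw [abs_le]; constructor <;> linarith [neg_abs_le t, le_abs_self t]
      linarith
    have h5 : (1 + |(⌊t⌋:ℝ)|) ^ b ≤ (3 + |t|) ^ b := by gcongr; linarith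
    have h6 : ((N:ℝ) + 1) ^ (a/4) ≤ (3 + |t|) ^ b := by
      calc ((N:ℝ) + 1) ^ (a/4) ≤ (3 + |t|) ^ (a/4) := by gcongr
        _ ≤ _ := Real.rpow_le_rpow_of_exponent_le (by linarith [abs_nonneg t]) hab
    have h7 : A ≤ A / (1 - q) := by rw [le_div_iff₀ h1q]; nlinarith
    have h8 : 0 ≤ A / (1 - q) := by positivity
    calc |f t i| = |f ⌊t⌋ i - (f ⌊t⌋ i - f t i)| := by congr 1; ring
      _ ≤ |f ⌊t⌋ i| + |f ⌊t⌋ i - f t i| := abs_sub _ _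
      _ ≤ A * (3 + |t|) ^ b + A * (3 + |t|) ^ b / (1 - q) := by
        refine add_le_add (h3.trans (by gcongr)) (this.trans (by gcongr))
      _ ≤ A / (1 - q) * (3 + |t|) ^ b + A / (1 - q) * (3 + |t|) ^ b := by
        refine add_le_add (by gcongr) (le_of_eq (by ring))
      _ ≤ _ := by
        have : 0 ≤ A / (1 - q) * (3 + |t|) ^ b := by positivity
        have e : 3 * A / (1 - q) * (3 + |t|) ^ b = 3 * (A / (1 - q) * (3 + |t|) ^ b) := by ring
        linarith

/-- reflection map -/
noncomputable def Refl {n : ℕ} (c : Fin n → ℝ) (f : ℝ → Fin n → ℝ) (t : ℝ) (i : Fin n) : ℝ :=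
  ⨆ s : Set.Iio t, (c i * (f t i - f s i) - (t - s))

lemma Refl_nonneg {n : ℕ} {c : Fin n → ℝ} {f : ℝ → Fin n → ℝ} {t : ℝ} {i : Fin n}
    (hf : Continuous fun t => f t i)
    (hb : BddAbove (Set.range fun s : Set.Iio t => c i * (f t i - f s i) - (t - s))) :
    0 ≤ Refl c f t i := by
  have h1 : Tendsto (fun s => c i * (f t i - f s i) - (t - s)) (𝓝[<] t) (𝓝 0) := by
    have : Continuous fun s => c i * (f t i - f s i) - (t - s) := by fun_prop
    have := (this.tendsto t).mono_left (nhdsWithin_le_nhds (s := Set.Iio t))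
    simpa using this
  refine le_of_tendsto h1 ?_
  filter_upwards [self_mem_nhdsWithin] with s hs
  exact le_ciSup hb ⟨s, hs⟩

lemma KS_continuous {n : ℕ} {A b q : ℝ} (hq0 : 0 ≤ q) (hq1 : q < 1)
    {f : ℝ → Fin n → ℝ} (hf : f ∈ KS n A b q) (i : Fin n) : Continuous fun t => f t i := by
  rw [Metric.continuous_iff]
  intro t ε hε
  set N := ⌈|t|⌉₊ + 1
  have hN : |t| + 1 ≤ N := by
    have := Nat.le_ceil |t|
    simp only [N]; push_cast; linarith
  have h0 : Tendsto (fun m : ℕ => A * (N + 2) * q ^ m) atTop (𝓝 0) := by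
    simpa using (tendsto_pow_atTop_nhds_zero_of_lt_one hq0 hq1).const_mul (A * ((N:ℝ) + 2))
  obtain ⟨m, hm⟩ := (h0.eventually_lt_const hε).exists
  refine ⟨(1/2) ^ m, by positivity, fun s hs => ?_⟩
  rw [Real.dist_eq] at hs ⊢
  have h1 : (1/2:ℝ) ^ m ≤ 1 := pow_le_one₀ (by norm_num) (by norm_num)
  have hs' : |s| ≤ N := by
    have : |s| ≤ |s - t| + |t| := by
      calc |s| = |(s - t) + t| := by congr 1; ring
        _ ≤ _ := abs_add_le _ _
    linarith
  exact ((hf i).1 N m t s (by linarith) hs' hs.le).trans_lt hm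

/-- far away terms do not contribute -/
lemma KS_far {n : ℕ} (c : Fin n → ℝ) {A b : ℝ} (q : ℝ) (hb1 : b < 1) (hA : 0 ≤ A)
    (hb0 : 0 ≤ b) (L : ℝ) (hL : 0 ≤ L) :
    ∃ T : ℝ, 0 ≤ T ∧ ∀ f ∈ KS n A b q, ∀ i, ∀ t ∈ Set.Icc 0 L, ∀ s < -T,
      c i * (f t i - f s i) - (t - s) ≤ 0 := by
  set M : ℝ := ∑ i, |c i| with hM
  have hM0 : 0 ≤ M := Finset.sum_nonneg fun i _ => abs_nonneg _
  have hMi : ∀ i, |c i| ≤ M := fun i =>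
    Finset.single_le_sum (f := fun i => |c i|) (fun i _ => abs_nonneg _) (Finset.mem_univ i)
  have h1 : Tendsto (fun x : ℝ => x - M * (A * (3 + L) ^ b + A * (3 + x) ^ b)) atTop atTop := by
    have h2 : (fun x : ℝ => (3 + x) ^ b) =o[atTop] fun x : ℝ => x := by
      have h3 : (fun x : ℝ => x ^ b) =o[atTop] fun x : ℝ => x := by
        rw [Asymptotics.isLittleO_iff_tendsto' ((eventually_gt_atTop 0).mono
          fun x hx h => absurd h (ne_of_gt hx))]
        refine (tendsto_rpow_neg_atTop (show 0 < 1 - b by linarith)).congr' ?_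
        filter_upwards [eventually_gt_atTop 0] with x hx
        rw [neg_sub, Real.rpow_sub_one hx.ne']
      have h4 := h3.comp_tendsto (tendsto_atTop_add_const_left atTop (3:ℝ) tendsto_id)
      refine h4.trans_isBigO ?_
      refine Asymptotics.IsBigO.of_bound 2 ?_
      filter_upwards [eventually_ge_atTop 3] with x hx
      simp only [Function.comp, id, Real.norm_eq_abs]
      rw [abs_of_nonneg (by linarith), abs_of_nonneg (by linarith)]; linarith
    have h3 : ∀ᶠ x : ℝ in atTop, M * A * (3 + x) ^ b ≤ x / 2 := by
      have := h2.def (c := 1 / (2 * (M * A + 1))) (by positivity)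
      filter_upwards [this, eventually_ge_atTop 0] with x hx hx0
      rw [Real.norm_of_nonneg (by positivity), Real.norm_of_nonneg hx0] at hx
      have h4 : (M * A + 1) * (3 + x) ^ b ≤ x / 2 := by
        calc (M * A + 1) * (3 + x) ^ b ≤ (M * A + 1) * (1 / (2 * (M * A + 1)) * x) := by gcongr
          _ = x / 2 := by field_simp
      have : (0:ℝ) ≤ (3 + x) ^ b := by positivity
      nlinarith
    have h5 : Tendsto (fun x : ℝ => x / 2 - M * (A * (3 + L) ^ b)) atTop atTop :=
      tendsto_atTop_add_const_right _ _ (tendsto_id.atTop_div_const (by norm_num))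
    refine tendsto_atTop_mono' _ ?_ h5
    filter_upwards [h3] with x hx
    nlinarith
  obtain ⟨T, hT⟩ := eventually_atTop.1 (h1.eventually_ge_atTop 0)
  refine ⟨max T 0, le_max_right _ _, fun f hf i t ht s hs => ?_⟩
  have hs1 : s < 0 := by linarith [le_max_right T 0]
  have h2 := hT (-s) (by linarith [le_max_left T 0])
  have h3 := (hf i).2 t
  have h4 := (hf i).2 s
  rw [abs_of_nonneg ht.1] at h3
  rw [abs_of_neg hs1] at h4
  have h5 : A * (3 + t) ^ b ≤ A * (3 + L) ^ b := by
    have := ht.1; have := ht.2; gcongr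
  have h6 : c i * (f t i - f s i) ≤ M * (A * (3 + L) ^ b + A * (3 + -s) ^ b) := by
    calc c i * (f t i - f s i) ≤ |c i * (f t i - f s i)| := le_abs_self _
      _ = |c i| * |f t i - f s i| := abs_mul _ _
      _ ≤ M * (|f t i| + |f s i|) := by
        gcongr
        · exact hMi i
        · exact abs_sub _ _
      _ ≤ _ := by gcongr; exact h3.trans h5
  linarith [ht.1]

lemma KS_bdd {n : ℕ} (c : Fin n → ℝ) {A b q : ℝ} (hb1 : b < 1) (hA : 0 ≤ A)
    (hb0 : 0 ≤ b) {f : ℝ → Fin n → ℝ} (hf : f ∈ KS n A b q) (i : Fin n) {t : ℝ} (ht : 0 ≤ t) :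
    BddAbove (Set.range fun s : Set.Iio t => c i * (f t i - f s i) - (t - s)) := by
  obtain ⟨T, hT0, hT⟩ := KS_far c q hb1 hA hb0 t ht
  refine ⟨|c i| * (A * (3 + t) ^ b + A * (3 + (t + T)) ^ b), ?_⟩
  rintro _ ⟨⟨s, hs⟩, rfl⟩
  have hs : s < t := hs
  simp only
  by_cases h : s < -T
  · exact (hT f hf i t ⟨ht, le_rfl⟩ s h).trans (by positivity)
  · push Not at h
    have h3 := (hf i).2 t
    have h4 := (hf i).2 s
    rw [abs_of_nonneg ht] at h3
    have h5 : |s| ≤ t + T := by rw [abs_le]; constructor <;> linarith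
    have h6 : A * (3 + |s|) ^ b ≤ A * (3 + (t + T)) ^ b := by gcongr
    calc c i * (f t i - f s i) - (t - s) ≤ |c i * (f t i - f s i)| := by
          linarith [le_abs_self (c i * (f t i - f s i))]
      _ = |c i| * |f t i - f s i| := abs_mul _ _
      _ ≤ |c i| * (|f t i| + |f s i|) := by gcongr; exact abs_sub _ _
      _ ≤ _ := by gcongr; exact h4.trans h6

lemma KS_unif {n : ℕ} {A b q : ℝ} (hq0 : 0 ≤ q) (hq1 : q < 1) {f : ℝ → Fin n → ℝ}
    (hf : f ∈ KS n A b q) (N : ℕ) {η : ℝ} (hη : 0 < η) :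
    ∀ᶠ g in 𝓝[KS n A b q] f, ∀ s : ℝ, |s| ≤ N → ∀ i, |g s i - f s i| ≤ η := by
  have h0 : Tendsto (fun m : ℕ => A * ((N + 1 : ℕ) + 2) * q ^ m) atTop (𝓝 0) := by
    simpa using (tendsto_pow_atTop_nhds_zero_of_lt_one hq0 hq1).const_mul (A * (((N+1:ℕ):ℝ) + 2))
  obtain ⟨m, hm⟩ := (h0.eventually_lt_const (show (0:ℝ) < η / 3 by positivity)).exists
  have h1 : ∀ᶠ g in 𝓝 f, ∀ k ∈ Finset.Icc (-(((N + 1) * 2 ^ m : ℕ) : ℤ)) (((N + 1) * 2 ^ m : ℕ) : ℤ),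
      ∀ i, |g (k / 2 ^ m) i - f (k / 2 ^ m) i| < η / 3 := by
    rw [Filter.eventually_all_finset]
    intro k _
    rw [Filter.eventually_all]
    intro i
    have hc : Continuous fun g : ℝ → Fin n → ℝ => |g (k / 2 ^ m) i - f (k / 2 ^ m) i| := by
      fun_prop
    have := hc.tendsto f
    simp only [sub_self, abs_zero] at this
    exact this.eventually_lt_const (by positivity)
  filter_upwards [nhdsWithin_le_nhds h1, self_mem_nhdsWithin] with g hg hgK s hs i
  have hp : (0:ℝ) < 2 ^ m := by positivity
  have hp1 : (1:ℝ) ≤ 2 ^ m := one_le_pow₀ (by norm_num)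
  set k := ⌊2 ^ m * s⌋ with hk
  have a1 := Int.floor_le (2 ^ m * s)
  have a2 := Int.lt_floor_add_one (2 ^ m * s)
  rw [← hk] at a1 a2
  have a3 := abs_le.1 hs
  have hkb : |(k:ℝ)| ≤ (N + 1) * 2 ^ m := by
    rw [abs_le]; constructor <;> nlinarith
  have hkb' := abs_le.1 hkb
  have hkI : k ∈ Finset.Icc (-(((N + 1) * 2 ^ m : ℕ) : ℤ)) (((N + 1) * 2 ^ m : ℕ) : ℤ) := by
    rw [Finset.mem_Icc]
    constructor
    · have : ((-(((N + 1) * 2 ^ m : ℕ) : ℤ) : ℤ) : ℝ) ≤ k := by push_cast; linarith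
      exact_mod_cast this
    · have : (k:ℝ) ≤ ((((N + 1) * 2 ^ m : ℕ) : ℤ) : ℝ) := by push_cast; linarith
      exact_mod_cast this
  have hks : |s - k / 2 ^ m| ≤ (1/2) ^ m := by
    have e : s - k / 2 ^ m = (2 ^ m * s - k) / 2 ^ m := by field_simp
    rw [e, abs_of_nonneg (by apply div_nonneg <;> linarith), div_le_iff₀ hp, ← mul_pow]
    norm_num; linarith
  have hkN : |(k:ℝ) / 2 ^ m| ≤ (N + 1 : ℕ) := by
    rw [abs_div, abs_of_pos hp, div_le_iff₀ hp]; push_cast; linarith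
  have hsN : |s| ≤ (N + 1 : ℕ) := by push_cast; linarith
  have b1 := (hf i).1 (N+1) m _ s hkN hsN hks
  have b2 := (hgK i).1 (N+1) m _ s hkN hsN hks
  have b3 := hg k hkI i
  have b1 := abs_le.1 (b1.trans hm.le)
  have b2 := abs_le.1 (b2.trans hm.le)
  have b3 := abs_lt.1 b3
  rw [abs_le]; constructor <;> linarith

/-- The reflection map as map into the function space. -/
noncomputable def ReflU {n : ℕ} (c : Fin n → ℝ) (f : ℝ → Fin n → ℝ) :
    UniformOnFun ↥(Set.Ici (0:ℝ)) (Fin n → ℝ) {K : Set ↥(Set.Ici (0:ℝ)) | IsCompact K} :=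
  UniformOnFun.ofFun _ (fun t : Set.Ici (0:ℝ) => Refl c f t)

lemma ReflU_continuousOn {n : ℕ} (c : Fin n → ℝ) {A b q : ℝ} (hb1 : b < 1) (hA : 0 ≤ A)
    (hb0 : 0 ≤ b) (hq0 : 0 ≤ q) (hq1 : q < 1) : ContinuousOn (ReflU c) (KS n A b q) := by
  intro f hf
  show Tendsto _ _ _
  rw [UniformOnFun.tendsto_iff_tendstoUniformlyOn]
  intro S hS
  have hS : IsCompact S := hS
  rw [Metric.tendstoUniformlyOn_iff]
  intro ε hε
  obtain ⟨L, hL⟩ := (hS.image continuous_subtype_val).bddAbove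
  have hL' : ∀ t ∈ S, (t:ℝ) ≤ L := fun t ht => hL ⟨t, ht, rfl⟩
  set L' := max L 0 with hL'def
  obtain ⟨T, hT0, hT⟩ := KS_far c q hb1 hA hb0 L' (le_max_right _ _)
  obtain ⟨N, hN⟩ := exists_nat_ge (L' + T)
  set M : ℝ := ∑ i, |c i| with hM
  have hM0 : 0 ≤ M := Finset.sum_nonneg fun i _ => abs_nonneg _
  have hMi : ∀ i, |c i| ≤ M := fun i =>
    Finset.single_le_sum (f := fun i => |c i|) (fun i _ => abs_nonneg _) (Finset.mem_univ i)
  have hη : 0 < ε / (4 * (M + 1)) := by positivity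
  have key : ∀ f ∈ KS n A b q, ∀ g ∈ KS n A b q,
      (∀ s : ℝ, |s| ≤ N → ∀ i, |g s i - f s i| ≤ ε / (4 * (M + 1))) →
      ∀ t ∈ S, ∀ i, Refl c f t i ≤ Refl c g t i + ε / 2 := by
    intro f hf g hg hfg t ht i
    have ht0 : (0:ℝ) ≤ t := t.2
    have htL : (t:ℝ) ≤ L' := (hL' t ht).trans (le_max_left _ _)
    have hbd := KS_bdd c hb1 hA hb0 hg i ht0
    have : Nonempty (Set.Iio (t:ℝ)) := ⟨⟨(t:ℝ) - 1, by simp⟩⟩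
    apply ciSup_le
    rintro ⟨s, hs⟩
    have hs : s < t := hs
    simp only
    by_cases h : s < -T
    · have h1 := hT f hf i t ⟨ht0, htL⟩ s h
      have h2 := Refl_nonneg (KS_continuous hq0 hq1 hg i) hbd
      linarith
    · push Not at h
      have h1 : c i * (g t i - g s i) - (t - s) ≤ Refl c g t i := le_ciSup hbd ⟨s, hs⟩
      have h2 := hfg t (by rw [abs_of_nonneg ht0]; linarith) i
      have h3 := hfg s (by rw [abs_le]; constructor <;> linarith [le_max_right L 0]) i
      have h4 : c i * ((f t i - f s i) - (g t i - g s i)) ≤ ε / 2 := by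
        calc c i * ((f t i - f s i) - (g t i - g s i))
            ≤ |c i * ((f t i - f s i) - (g t i - g s i))| := le_abs_self _
          _ = |c i| * |(g s i - f s i) - (g t i - f t i)| := by
            rw [abs_mul]; congr 2; ring
          _ ≤ M * (ε / (4 * (M + 1)) + ε / (4 * (M + 1))) := by
            gcongr
            · exact hMi i
            · exact (abs_sub _ _).trans (add_le_add h3 h2)
          _ ≤ (M + 1) * (ε / (4 * (M + 1)) + ε / (4 * (M + 1))) := by gcongr; linarith
          _ = ε / 2 := by field_simp; ring
      linarith
  filter_upwards [KS_unif hq0 hq1 hf N hη, self_mem_nhdsWithin] with g hg hgK t ht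
  refine lt_of_le_of_lt ?_ (half_lt_self hε)
  rw [dist_pi_le_iff (by positivity)]
  intro i
  have k1 := key f hf g hgK hg t ht i
  have k2 := key g hgK f hf (fun s hs i => by rw [abs_sub_comm]; exact hg s hs i) t ht i
  show dist (Refl c f t i) (Refl c g t i) ≤ _
  rw [Real.dist_eq, abs_le]; constructor <;> linarith

open MeasureTheory ProbabilityTheory Filter Topology

/-- absolute moments of the standard normal law -/
noncomputable def gM (p : ℕ) : ℝ := ∫ x, |x| ^ p ∂(gaussianReal 0 1)

lemma gM_nonneg (p : ℕ) : 0 ≤ gM p := integral_nonneg fun x => by positivity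

lemma gauss_tail {v : NNReal} {s w : ℝ} (hv : √(v:ℝ) ≤ s) (hw : 0 < w) (p : ℕ) :
    gaussianReal 0 v {x | w < |x|} ≤ ENNReal.ofReal (gM p * (s / w) ^ p) := by
  have hs : 0 ≤ s := (Real.sqrt_nonneg _).trans hv
  have h1 : (gaussianReal 0 1).map (√(v:ℝ) * ·) = gaussianReal 0 v := by
    rw [gaussianReal_map_const_mul]
    congr 1
    · simp
    · ext; simp
  rw [← h1, Measure.map_apply (by fun_prop) (measurableSet_lt (by fun_prop) (by fun_prop))]
  have h2 : ((√(v:ℝ) * ·) ⁻¹' {x | w < |x|}) ⊆ {x | w ^ p ≤ s ^ p * |x| ^ p} := by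
    intro x hx
    simp only [Set.mem_preimage, Set.mem_setOf_eq] at hx ⊢
    rw [abs_mul, abs_of_nonneg (Real.sqrt_nonneg _)] at hx
    rw [← mul_pow]
    apply pow_le_pow_left₀ hw.le
    exact hx.le.trans (by gcongr)
  refine (measure_mono h2).trans ?_
  have hInt : Integrable (fun x : ℝ => |x| ^ p) (gaussianReal 0 1) := by
    have := (memLp_id_gaussianReal (μ := 0) (v := 1) (p : NNReal)).integrable_norm_pow'
    simpa using this
  have h3 := mul_meas_ge_le_integral_of_nonneg (μ := gaussianReal 0 1)
    (f := fun x => s ^ p * |x| ^ p) (ae_of_all _ fun x => by positivity) (hInt.const_mul _) (w ^ p)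
  rw [integral_const_mul] at h3
  rw [ENNReal.le_ofReal_iff_toReal_le (measure_ne_top _ _) (by have := gM_nonneg p; positivity)]
  rw [div_pow, mul_div_assoc', le_div_iff₀ (by positivity)]
  unfold gM
  calc _ = w ^ p * (gaussianReal 0 1).real {x | w ^ p ≤ s ^ p * |x| ^ p} := by
        rw [mul_comm]; rfl
    _ ≤ _ := h3
    _ = _ := by ring

lemma union_bound {Ω : Type*} [MeasurableSpace Ω] {P : Measure Ω} {ι : Type*} [Countable ι]
    {Z : ι → Ω → ℝ} (hZ : ∀ j, Measurable (Z j)) {s w W : ι → ℝ} {D : ℝ} (p : ℕ)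
    (hlaw : ∀ j, ∃ v : NNReal, P.map (Z j) = gaussianReal 0 v ∧ √(v:ℝ) ≤ s j)
    (hw : ∀ j, 0 < w j) (hW : Summable W) (hW0 : ∀ j, 0 ≤ W j) (hD : 0 ≤ D)
    (hsw : ∀ j, (s j / w j) ^ p ≤ D * W j) :
    P (⋃ j, {ω | w j < |Z j ω|}) ≤ ENNReal.ofReal (gM p * D * ∑' j, W j) := by
  have hg := gM_nonneg p
  calc P (⋃ j, {ω | w j < |Z j ω|}) ≤ ∑' j, P {ω | w j < |Z j ω|} := measure_iUnion_le _
    _ ≤ ∑' j, ENNReal.ofReal (gM p * D * W j) := by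
      refine ENNReal.tsum_le_tsum fun j => ?_
      obtain ⟨v, hv, hvs⟩ := hlaw j
      have h1 := gauss_tail hvs (hw j) p
      rw [← hv, Measure.map_apply (hZ j) (measurableSet_lt (by fun_prop) (by fun_prop))] at h1
      refine h1.trans (ENNReal.ofReal_le_ofReal ?_)
      rw [mul_assoc]
      exact mul_le_mul_of_nonneg_left (hsw j) hg
    _ = ENNReal.ofReal (∑' j, gM p * D * W j) := by
      rw [ENNReal.ofReal_tsum_of_nonneg (fun j => by have := hW0 j; positivity)
        (hW.mul_left _)]
    _ = _ := by rw [tsum_mul_left]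

lemma summable_int_sq : Summable fun k : ℤ => ((1 + |(k:ℝ)|) ^ 2)⁻¹ := by
  have h : Summable fun n : ℕ => ((1 + (n:ℝ)) ^ 2)⁻¹ := by
    have := (summable_nat_add_iff 1).2 (Real.summable_nat_pow_inv (p := 2).2 (by norm_num))
    refine this.congr fun n => ?_
    push_cast; rw [add_comm]
  apply Summable.of_nat_of_neg
  · simpa using h
  · simpa using h

lemma KS_mono {n : ℕ} {A A' b q : ℝ} (h : A ≤ A') (hq : 0 ≤ q) : KS n A b q ⊆ KS n A' b q := by
  intro f hf i
  refine ⟨fun N m s t h1 h2 h3 => ((hf i).1 N m s t h1 h2 h3).trans ?_,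
    fun t => ((hf i).2 t).trans ?_⟩
  · gcongr
  · gcongr

set_option maxHeartbeats 1000000 in
/-- Uniform tightness. -/
lemma prob_KS.{u} {a b K : ℝ} (ha : 0 < a) (hab : a < b) (hb : b < 1) (hK : 0 ≤ K) (n : ℕ)
    {ε : ℝ} (hε : 0 < ε) :
    ∃ A : ℝ, 0 ≤ A ∧ ∀ {Ω : Type u} [MeasurableSpace Ω] (P : Measure Ω)
      (X : ℝ → Ω → Fin n → ℝ) (_ : ∀ ω i, Continuous fun t => X t ω i)
      (_ : ∀ t i, Measurable fun ω => X t ω i)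
      (_ : ∀ i t s, ∃ v : NNReal, P.map (fun ω => X t ω i - X s ω i) = gaussianReal 0 v ∧
        √(v:ℝ) ≤ K * (|t - s| ^ a + |t - s| ^ b))
      (_ : ∀ i t, ∃ v : NNReal, P.map (fun ω => X t ω i) = gaussianReal 0 v ∧
        √(v:ℝ) ≤ K * (|t| ^ a + |t| ^ b)),
      ∃ E : Set Ω, MeasurableSet E ∧ P Eᶜ ≤ ENNReal.ofReal ε ∧
        ∀ ω ∈ E, (fun t i => X t ω i) ∈ KS n A ((1 + b) / 2) ((2:ℝ) ^ (-(a/4))) := by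
  obtain ⟨p, hp⟩ := exists_nat_ge (max 1 (max (2 / (a / 4)) (2 / ((1 - b) / 2))))
  have hp1 : (1:ℝ) ≤ p := (le_max_left _ _).trans hp
  have hp1' : 1 ≤ p := by exact_mod_cast hp1
  have hp2 : 2 ≤ a / 4 * p := by
    have := (le_max_left _ _).trans ((le_max_right _ _).trans hp)
    rw [div_le_iff₀ (by positivity)] at this; linarith
  have hp3 : 2 ≤ (1 - b) / 2 * p := by
    have := (le_max_right _ _).trans ((le_max_right _ _).trans hp)
    rw [div_le_iff₀ (by linarith)] at this; linarith
  set q2 := (2:ℝ) ^ (-(a / 2) * p) with hq2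
  have hq2p : 0 < q2 := by positivity
  have hq21 : q2 < 1 := Real.rpow_lt_one_of_one_lt_of_neg (by norm_num) (by nlinarith)
  set W1 : Fin n × ℕ × ℤ → ℝ := fun x => 1 * (q2 ^ x.2.1 * ((1 + |(x.2.2:ℝ)|) ^ 2)⁻¹) with hW1
  set W2 : Fin n × ℤ → ℝ := fun x => 1 * ((1 + |(x.2:ℝ)|) ^ 2)⁻¹ with hW2
  have hS1 : Summable W1 := by
    have h1 := (summable_geometric_of_lt_one hq2p.le hq21).mul_of_nonneg summable_int_sq
      (fun m => by positivity) (fun k => by positivity)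
    exact Summable.mul_of_nonneg (f := fun _ : Fin n => (1:ℝ))
      (g := fun x : ℕ × ℤ => q2 ^ x.1 * ((1 + |(x.2:ℝ)|) ^ 2)⁻¹) (Summable.of_finite) h1
      (fun _ => zero_le_one) (fun x => by positivity)
  have hS2 : Summable W2 := by
    exact Summable.mul_of_nonneg (f := fun _ : Fin n => (1:ℝ)) (g := fun k : ℤ => ((1 + |(k:ℝ)|) ^ 2)⁻¹)
      (Summable.of_finite) summable_int_sq (fun _ => zero_le_one) (fun x => by positivity)
  have hlim : Tendsto (fun A : ℝ => gM p * (2 * K / A) ^ p * ∑' j, W1 j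
      + gM p * (2 * K / A) ^ p * ∑' j, W2 j) atTop (𝓝 0) := by
    have h1 : Tendsto (fun A : ℝ => (2 * K / A) ^ p) atTop (𝓝 0) := by
      have := (tendsto_const_nhds (x := 2 * K)).div_atTop (tendsto_id (α := ℝ)) |>.pow p
      simpa [show p ≠ 0 by omega] using this
    have h2 := ((h1.const_mul (gM p)).mul_const (∑' j, W1 j)).add
      ((h1.const_mul (gM p)).mul_const (∑' j, W2 j))
    simpa using h2
  obtain ⟨A, hAε, hA⟩ := ((hlim.eventually_lt_const hε).and (eventually_gt_atTop 0)).exists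
  have hq1 : (2:ℝ) ^ (-(a/4)) < 1 := Real.rpow_lt_one_of_one_lt_of_neg (by norm_num) (by linarith)
  refine ⟨3 * A / (1 - (2:ℝ) ^ (-(a/4))), div_nonneg (by positivity) (by linarith), ?_⟩
  intro Ω _ P X hcont hmeas hincr hsing
  set S1 : Set Ω := ⋃ x : Fin n × ℕ × ℤ,
    {ω | A * ((2:ℝ) ^ (-(a / 2) * x.2.1) * (1 + |(x.2.2:ℝ)|) ^ (a / 4))
      < |X ((x.2.2 + 1) / 2 ^ x.2.1) ω x.1 - X (x.2.2 / 2 ^ x.2.1) ω x.1|} with hS1def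
  set S2 : Set Ω := ⋃ x : Fin n × ℤ,
    {ω | A * (1 + |(x.2:ℝ)|) ^ ((1 + b) / 2) < |X x.2 ω x.1|} with hS2def
  have hS1m : MeasurableSet S1 := by
    refine MeasurableSet.iUnion fun x => measurableSet_lt measurable_const ?_
    exact ((hmeas _ _).sub (hmeas _ _)).abs
  have hS2m : MeasurableSet S2 := by
    refine MeasurableSet.iUnion fun x => measurableSet_lt measurable_const ?_
    exact (hmeas _ _).abs
  have hD : 0 ≤ (2 * K / A) ^ p := by positivity
  have hB1 : P S1 ≤ ENNReal.ofReal (gM p * (2 * K / A) ^ p * ∑' j, W1 j) := by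
    refine union_bound (Z := fun x : Fin n × ℕ × ℤ => fun ω =>
        X ((x.2.2 + 1) / 2 ^ x.2.1) ω x.1 - X (x.2.2 / 2 ^ x.2.1) ω x.1)
      (s := fun x => 2 * K * (2:ℝ) ^ (-a * x.2.1)) (fun x => (hmeas _ _).sub (hmeas _ _)) p ?_
      (fun x => by positivity) hS1 (fun x => by positivity) hD ?_
    · rintro ⟨i, m, k⟩
      obtain ⟨v, hv1, hv2⟩ := hincr i ((k + 1) / 2 ^ m) (k / 2 ^ m)
      refine ⟨v, hv1, hv2.trans ?_⟩
      have hpm : (0:ℝ) < 2 ^ m := by positivity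
      have e : |((k:ℝ) + 1) / 2 ^ m - k / 2 ^ m| = (2:ℝ) ^ (-(m:ℝ)) := by
        rw [← sub_div, add_sub_cancel_left, abs_of_pos (by positivity), Real.rpow_neg (by norm_num),
          Real.rpow_natCast, one_div]
      rw [e, ← Real.rpow_mul (by norm_num), ← Real.rpow_mul (by norm_num)]
      have h1 : (2:ℝ) ^ (-(m:ℝ) * b) ≤ (2:ℝ) ^ (-a * m) := by
        apply Real.rpow_le_rpow_of_exponent_le (by norm_num)
        have : (0:ℝ) ≤ m := Nat.cast_nonneg m
        nlinarith
      have h2 : (2:ℝ) ^ (-(m:ℝ) * a) = (2:ℝ) ^ (-a * m) := by congr 1; ring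
      rw [h2]
      show _ ≤ 2 * K * (2:ℝ) ^ (-a * m)
      nlinarith
    · rintro ⟨i, m, k⟩
      simp only [hW1]
      have hk : (0:ℝ) < 1 + |(k:ℝ)| := by positivity
      have e : 2 * K * (2:ℝ) ^ (-a * m) / (A * ((2:ℝ) ^ (-(a / 2) * m) * (1 + |(k:ℝ)|) ^ (a / 4)))
          = 2 * K / A * ((2:ℝ) ^ (-(a / 2) * m) * (1 + |(k:ℝ)|) ^ (-(a / 4))) := by
        rw [Real.rpow_neg hk.le, show -a * (m:ℝ) = -(a/2) * m + -(a/2) * m by ring,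
          Real.rpow_add (by norm_num)]
        have : (2:ℝ) ^ (-(a / 2) * m) ≠ 0 := by positivity
        have : (1 + |(k:ℝ)|) ^ (a / 4) ≠ 0 := by positivity
        field_simp
      rw [e, mul_pow, mul_pow]
      refine mul_le_mul_of_nonneg_left ?_ hD
      rw [one_mul]
      have e1 : ((2:ℝ) ^ (-(a / 2) * m)) ^ p = q2 ^ m := by
        rw [hq2, ← Real.rpow_natCast, ← Real.rpow_mul (by norm_num), ← Real.rpow_natCast (2 ^ _) m,
          ← Real.rpow_mul (by norm_num)]
        congr 1; ring
      rw [e1]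
      refine mul_le_mul_of_nonneg_left ?_ (by positivity)
      rw [← Real.rpow_natCast, ← Real.rpow_mul hk.le, ← Real.rpow_natCast, ← Real.rpow_neg hk.le]
      apply Real.rpow_le_rpow_of_exponent_le (by linarith [abs_nonneg (k:ℝ)])
      push_cast; linarith
  have hB2 : P S2 ≤ ENNReal.ofReal (gM p * (2 * K / A) ^ p * ∑' j, W2 j) := by
    refine union_bound (Z := fun x : Fin n × ℤ => fun ω => X x.2 ω x.1)
      (s := fun x => 2 * K * (1 + |(x.2:ℝ)|) ^ b) (fun x => hmeas _ _) p ?_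
      (fun x => by positivity) hS2 (fun x => by positivity) hD ?_
    · rintro ⟨i, k⟩
      obtain ⟨v, hv1, hv2⟩ := hsing i k
      refine ⟨v, hv1, hv2.trans ?_⟩
      have hk : (0:ℝ) ≤ |(k:ℝ)| := abs_nonneg _
      have h1 : |(k:ℝ)| ^ a ≤ (1 + |(k:ℝ)|) ^ b :=
        (Real.rpow_le_rpow hk (by linarith) ha.le).trans
          (Real.rpow_le_rpow_of_exponent_le (by linarith) hab.le)
      have h2 : |(k:ℝ)| ^ b ≤ (1 + |(k:ℝ)|) ^ b := Real.rpow_le_rpow hk (by linarith) (by linarith)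
      show _ ≤ 2 * K * (1 + |(k:ℝ)|) ^ b
      nlinarith
    · rintro ⟨i, k⟩
      simp only [hW2]
      have hk : (0:ℝ) < 1 + |(k:ℝ)| := by positivity
      have e : 2 * K * (1 + |(k:ℝ)|) ^ b / (A * (1 + |(k:ℝ)|) ^ ((1 + b) / 2))
          = 2 * K / A * (1 + |(k:ℝ)|) ^ (-((1 - b) / 2)) := by
        rw [show -((1 - b)/2) = b - (1 + b)/2 by ring, Real.rpow_sub hk]
        have : (1 + |(k:ℝ)|) ^ ((1 + b) / 2) ≠ 0 := by positivity
        field_simp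
      rw [e, mul_pow]
      refine mul_le_mul_of_nonneg_left ?_ hD
      rw [one_mul]
      rw [← Real.rpow_natCast, ← Real.rpow_mul hk.le, ← Real.rpow_natCast, ← Real.rpow_neg hk.le]
      apply Real.rpow_le_rpow_of_exponent_le (by linarith [abs_nonneg (k:ℝ)])
      push_cast; linarith
  refine ⟨(S1 ∪ S2)ᶜ, (hS1m.union hS2m).compl, ?_, ?_⟩
  · rw [compl_compl]
    have hg := gM_nonneg p
    have t1 : 0 ≤ ∑' j, W1 j := tsum_nonneg fun x => by positivity
    have t2 : 0 ≤ ∑' j, W2 j := tsum_nonneg fun x => by positivity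
    calc P (S1 ∪ S2) ≤ P S1 + P S2 := measure_union_le _ _
      _ ≤ _ := add_le_add hB1 hB2
      _ = _ := (ENNReal.ofReal_add (by positivity) (by positivity)).symm
      _ ≤ _ := ENNReal.ofReal_le_ofReal hAε.le
  · intro ω hω
    simp only [Set.mem_compl_iff, Set.mem_union, not_or, hS1def, hS2def, Set.mem_iUnion,
      Set.mem_setOf_eq, not_exists, not_lt] at hω
    exact mem_KS ha (by linarith) (by linarith) hA.le (hcont ω)
      (fun i m k => hω.1 (i, m, k)) (fun i k => hω.2 (i, k))

open MeasureTheory ProbabilityTheory Filter Topology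

/-- cylinder functions on a subset of the product space -/
noncomputable def cylAlg (n : ℕ) (K : Set (ℝ → Fin n → ℝ)) : Subalgebra ℝ C(K, ℝ) where
  carrier := {φ | ∃ (k : ℕ) (t : Fin k → ℝ) (g : C(Fin k → Fin n → ℝ, ℝ)),
    ∀ f : K, φ f = g (fun a => f.1 (t a))}
  mul_mem' := by
    rintro φ ψ ⟨k, t, g, hg⟩ ⟨k', t', g', hg'⟩
    refine ⟨k + k', Fin.append t t', ⟨fun x => g (fun a => x (Fin.castAdd k' a)) *
      g' (fun a => x (Fin.natAdd k a)), by fun_prop⟩, fun f => ?_⟩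
    simp [hg, hg']
  add_mem' := by
    rintro φ ψ ⟨k, t, g, hg⟩ ⟨k', t', g', hg'⟩
    refine ⟨k + k', Fin.append t t', ⟨fun x => g (fun a => x (Fin.castAdd k' a)) +
      g' (fun a => x (Fin.natAdd k a)), by fun_prop⟩, fun f => ?_⟩
    simp [hg, hg']
  algebraMap_mem' := by
    intro r
    refine ⟨0, Fin.elim0, ContinuousMap.const _ r, fun f => ?_⟩
    simp

lemma cyl_approx {n : ℕ} {K : Set (ℝ → Fin n → ℝ)} (hK : IsCompact K)
    {G : (ℝ → Fin n → ℝ) → ℝ} (hG : ContinuousOn G K) {M : ℝ} (hM : ∀ f, |G f| ≤ M)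
    {ε : ℝ} (hε : 0 < ε) :
    ∃ (k : ℕ) (t : Fin k → ℝ) (g : (Fin k → Fin n → ℝ) → ℝ), Continuous g ∧ (∀ x, |g x| ≤ M) ∧
      ∀ f ∈ K, |G f - g (fun a => f (t a))| ≤ ε := by
  have : CompactSpace K := isCompact_iff_compactSpace.1 hK
  have hsep : (cylAlg n K).SeparatesPoints := by
    intro f f' hne
    have h1 : f.1 ≠ f'.1 := fun h => hne (Subtype.ext h)
    obtain ⟨t, ht⟩ := Function.ne_iff.1 h1
    obtain ⟨i, hi⟩ := Function.ne_iff.1 ht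
    refine ⟨fun f => f.1 t i, ?_, hi⟩
    refine ⟨⟨fun f => f.1 t i, (continuous_apply i).comp ((continuous_apply t).comp
      continuous_subtype_val)⟩, ?_, rfl⟩
    exact ⟨1, fun _ => t, ⟨fun x => x 0 i, by fun_prop⟩, fun f => rfl⟩
  obtain ⟨⟨φ, k, t, g, hg⟩, hφ⟩ :=
    ContinuousMap.exists_mem_subalgebra_near_continuousMap_of_separatesPoints
    (cylAlg n K) hsep ⟨K.domRestrict G, continuousOn_iff_continuous_domRestrict.1 hG⟩ ε hε
  have hM0 : 0 ≤ M := (abs_nonneg _).trans (hM 0)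
  refine ⟨k, t, fun x => max (-M) (min M (g x)), by fun_prop, fun x => ?_, fun f hf => ?_⟩
  · rw [abs_le]
    exact ⟨le_max_left _ _, max_le (by linarith) (min_le_left _ _)⟩
  · have h1 := (ContinuousMap.norm_coe_le_norm _ (⟨f, hf⟩ : K)).trans hφ.le
    simp only [ContinuousMap.coe_sub, Pi.sub_apply] at h1
    rw [hg, Real.norm_eq_abs, abs_sub_comm] at h1
    have h1 : |G f - g (fun a => f (t a))| ≤ ε := h1
    refine le_trans ?_ h1
    have h2 := abs_le.1 (hM f)
    have e : G f = max (-M) (min M (G f)) := by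
      rw [min_eq_right h2.2, max_eq_right h2.1]
    calc |G f - max (-M) (min M (g fun a => f (t a)))|
        = |max (-M) (min M (G f)) - max (-M) (min M (g fun a => f (t a)))| := by rw [← e]
      _ ≤ |min M (G f) - min M (g fun a => f (t a))| := by
        have := abs_max_sub_max_le_max (-M) (min M (G f)) (-M) (min M (g fun a => f (t a)))
        simpa using this
      _ ≤ _ := by
        have := abs_min_sub_min_le_max M (G f) M (g fun a => f (t a))
        simpa using this

lemma charFun_gauss_vec {Ω₁ : Type*} [MeasurableSpace Ω₁] {ι : Type*} [Fintype ι] (Q : Measure Ω₁)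
    (X : Ω₁ → ι → ℝ) (hX : Measurable X) (c : EuclideanSpace ℝ ι) (v : NNReal)
    (hv : Q.map (fun ω => ∑ x, c x * X ω x) = gaussianReal 0 v) :
    charFun (Q.map fun ω => WithLp.toLp 2 (X ω)) c = Complex.exp (-(v:ℂ) / 2) := by
  have hXm : Measurable fun ω => WithLp.toLp 2 (X ω) :=
    (MeasurableEquiv.toLp 2 (ι → ℝ)).measurable.comp hX
  have hXs : Measurable fun ω => ∑ x, c x * X ω x := by fun_prop
  have e1 : charFun (gaussianReal 0 v) 1 = Complex.exp (-(v:ℂ) / 2) := by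
    rw [charFun_gaussianReal]; congr 1; simp; ring
  rw [← e1, ← hv, charFun_apply, charFun_apply,
    integral_map hXm.aemeasurable (by fun_prop),
    integral_map hXs.aemeasurable (by fun_prop)]
  refine integral_congr_ae (ae_of_all _ fun ω => ?_)
  simp only
  congr 3
  rw [PiLp.inner_apply]
  simp

/-- Lévy continuity for Gaussian vectors. -/
lemma gauss_conv {Ω Ω' : Type*} [MeasurableSpace Ω] [MeasurableSpace Ω']
    {P : Measure Ω} {P' : Measure Ω'} [IsProbabilityMeasure P] [IsProbabilityMeasure P']
    {ι : Type*} [Fintype ι] {Y : ℕ → Ω → ι → ℝ} {Z : Ω' → ι → ℝ}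
    (hY : ∀ u, Measurable (Y u)) (hZ : Measurable Z) {Vu : ℕ → (ι → ℝ) → ℝ} {V : (ι → ℝ) → ℝ}
    (h1 : ∀ u c, P.map (fun ω => ∑ x, c x * Y u ω x) = gaussianReal 0 (Vu u c).toNNReal)
    (h2 : ∀ c, P'.map (fun ω => ∑ x, c x * Z ω x) = gaussianReal 0 (V c).toNNReal)
    (hV : ∀ c, Tendsto (fun u => Vu u c) atTop (𝓝 (V c)))
    {g : (ι → ℝ) → ℝ} (hg : Continuous g) {M : ℝ} (hM : ∀ x, |g x| ≤ M) :
    Tendsto (fun u => ∫ ω, g (Y u ω) ∂P) atTop (𝓝 (∫ ω, g (Z ω) ∂P')) := by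
  have hYm : ∀ u, Measurable fun ω => WithLp.toLp 2 (Y u ω) := fun u =>
    (MeasurableEquiv.toLp 2 (ι → ℝ)).measurable.comp (hY u)
  have hZm : Measurable fun ω => WithLp.toLp 2 (Z ω) :=
    (MeasurableEquiv.toLp 2 (ι → ℝ)).measurable.comp hZ
  let μ : ℕ → ProbabilityMeasure (EuclideanSpace ℝ ι) := fun u =>
    ⟨P.map fun ω => WithLp.toLp 2 (Y u ω), Measure.isProbabilityMeasure_map (hYm u).aemeasurable⟩
  let μ₀ : ProbabilityMeasure (EuclideanSpace ℝ ι) :=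
    ⟨P'.map fun ω => WithLp.toLp 2 (Z ω), Measure.isProbabilityMeasure_map hZm.aemeasurable⟩
  have hconv : Tendsto μ atTop (𝓝 μ₀) := by
    apply ProbabilityMeasure.tendsto_of_tendsto_charFun
    intro c
    have e1 : charFun (μ₀ : Measure (EuclideanSpace ℝ ι)) c = _ :=
      charFun_gauss_vec P' Z hZ c _ (h2 c)
    have e2 : ∀ u, charFun (μ u : Measure (EuclideanSpace ℝ ι)) c = _ := fun u =>
      charFun_gauss_vec P (Y u) (hY u) c _ (h1 u c)
    simp only [e1, e2]
    have hc : Continuous fun x : ℝ => Complex.exp (-((x.toNNReal : ℝ) : ℂ) / 2) := by fun_prop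
    exact (hc.tendsto _).comp (hV c)
  rw [ProbabilityMeasure.tendsto_iff_forall_integral_tendsto] at hconv
  let F : BoundedContinuousFunction (EuclideanSpace ℝ ι) ℝ :=
    BoundedContinuousFunction.ofNormedAddCommGroup (fun x => g (WithLp.ofLp x)) (by fun_prop) M
      (fun x => hM _)
  have := hconv F
  have e1 : ∀ u, ∫ x, F x ∂(μ u : Measure (EuclideanSpace ℝ ι)) = ∫ ω, g (Y u ω) ∂P := fun u =>
    integral_map (hYm u).aemeasurable (F.continuous.aestronglyMeasurable)
  have e2 : ∫ x, F x ∂(μ₀ : Measure (EuclideanSpace ℝ ι)) = ∫ ω, g (Z ω) ∂P' :=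
    integral_map hZm.aemeasurable (F.continuous.aestronglyMeasurable)
  simpa only [e1, e2] using this

open MeasureTheory ProbabilityTheory Filter Topology

section
variable {Ω : Type*} [MeasurableSpace Ω] {P : Measure Ω}

/-- The scaled input process. -/
noncomputable def Xs {n : ℕ} (σ : ℝ → ℝ) (J : ℝ → Ω → ℝ) (d : Fin n → ℝ) (t : ℝ) (ω : Ω)
    (i : Fin n) : ℝ := J (d i * t) ω / σ (d i)

lemma Xs_law {n : ℕ} {σ : ℝ → ℝ} {J : ℝ → Ω → ℝ}
    (hJ : IsCenteredGaussian1 P J (covFromStd σ)) (d : Fin n → ℝ) {k : ℕ} (t : Fin k → ℝ)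
    (c : Fin k × Fin n → ℝ) :
    P.map (fun ω => ∑ x, c x * Xs σ J d (t x.1) ω x.2) =
      gaussianReal 0 (∑ x, ∑ y, c x * c y *
        (covFromStd σ (d x.2 * t x.1) (d y.2 * t y.1) / (σ (d x.2) * σ (d y.2)))).toNNReal := by
  have h := hJ.2 (k * n) (fun z => d (finProdFinEquiv.symm z).2 * t (finProdFinEquiv.symm z).1)
    (fun z => c (finProdFinEquiv.symm z) / σ (d (finProdFinEquiv.symm z).2))
  have e1 : ∀ ω, ∑ z, c (finProdFinEquiv.symm z) / σ (d (finProdFinEquiv.symm z).2) *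
      J (d (finProdFinEquiv.symm z).2 * t (finProdFinEquiv.symm z).1) ω
      = ∑ x, c x * Xs σ J d (t x.1) ω x.2 := by
    intro ω
    rw [Equiv.sum_comp finProdFinEquiv.symm
      (fun x : Fin k × Fin n => c x / σ (d x.2) * J (d x.2 * t x.1) ω)]
    refine Finset.sum_congr rfl fun x _ => ?_
    simp only [Xs]; ring
  simp only [e1] at h
  rw [h]
  congr 2
  rw [Equiv.sum_comp finProdFinEquiv.symm
      (fun x : Fin k × Fin n => ∑ z, c x / σ (d x.2) * (c (finProdFinEquiv.symm z) /
        σ (d (finProdFinEquiv.symm z).2)) * covFromStd σ (d x.2 * t x.1)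
          (d (finProdFinEquiv.symm z).2 * t (finProdFinEquiv.symm z).1))]
  refine Finset.sum_congr rfl fun x _ => ?_
  rw [Equiv.sum_comp finProdFinEquiv.symm
      (fun y : Fin k × Fin n => c x / σ (d x.2) * (c y /
        σ (d y.2)) * covFromStd σ (d x.2 * t x.1)
          (d y.2 * t y.1))]
  refine Finset.sum_congr rfl fun y _ => ?_
  ring

lemma B_law {n : ℕ} {B : ℝ → Ω → Fin n → ℝ} {Kc : Fin n → Fin n → ℝ → ℝ → ℝ}
    (hB : IsCenteredGaussianVec P B Kc) {k : ℕ} (t : Fin k → ℝ)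
    (c : Fin k × Fin n → ℝ) :
    P.map (fun ω => ∑ x, c x * B (t x.1) ω x.2) =
      gaussianReal 0 (∑ x, ∑ y, c x * c y * Kc x.2 y.2 (t x.1) (t y.1)).toNNReal := by
  have h := hB.2 k t (fun a i => c (a, i))
  have e1 : ∀ ω, ∑ a, ∑ i, c (a, i) * B (t a) ω i = ∑ x, c x * B (t x.1) ω x.2 := by
    intro ω
    rw [Fintype.sum_prod_type]
  simp only [e1] at h
  rw [h]
  congr 2
  rw [Fintype.sum_prod_type]
  refine Finset.sum_congr rfl fun a _ => ?_
  rw [Finset.sum_comm]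
  refine Finset.sum_congr rfl fun i _ => ?_
  rw [Fintype.sum_prod_type]

lemma law_div {Z : Ω → ℝ} (hZ : Measurable Z) {w : ℝ} (hw : 0 ≤ w)
    (h : P.map Z = gaussianReal 0 (w ^ 2).toNNReal) {r : ℝ} (hr : 0 < r) :
    ∃ v : NNReal, P.map (fun ω => Z ω / r) = gaussianReal 0 v ∧ √(v:ℝ) = w / r := by
  refine ⟨((w / r) ^ 2).toNNReal, ?_, ?_⟩
  · have h1 : P.map (fun ω => Z ω / r) = (P.map Z).map (r⁻¹ * ·) := by
      rw [Measure.map_map (by fun_prop) hZ]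
      congr 1; ext ω; simp; ring
    rw [h1, h, gaussianReal_map_const_mul]
    congr 1
    · simp
    · ext
      simp
      rw [max_eq_left (by positivity), max_eq_left (by positivity)]
      ring
  · rw [Real.coe_toNNReal _ (by positivity), Real.sqrt_sq (by positivity)]

lemma Xs_bounds {n : ℕ} {σ : ℝ → ℝ} {J : ℝ → Ω → ℝ} {lam K a b dd : ℝ}
    (H : SigHyp σ lam K a b dd)
    (hJ : IsCenteredGaussian1 P J (covFromStd σ)) [IsProbabilityMeasure P]
    {d : Fin n → ℝ} (hd : ∀ i, 0 < d i ∧ d i ≤ dd) :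
    (∀ i t s, ∃ v : NNReal, P.map (fun ω => Xs σ J d t ω i - Xs σ J d s ω i) = gaussianReal 0 v ∧
        √(v:ℝ) ≤ K * (|t - s| ^ a + |t - s| ^ b)) ∧
    (∀ i t, ∃ v : NNReal, P.map (fun ω => Xs σ J d t ω i) = gaussianReal 0 v ∧
        √(v:ℝ) ≤ K * (|t| ^ a + |t| ^ b)) := by
  constructor
  · intro i t s
    have hs := H.pos _ (hd i).1
    obtain ⟨v, h1, h2⟩ := law_div ((hJ.1 (d i * t)).sub (hJ.1 (d i * s))) (H.nonneg _)
      (incr_law H.zero hJ (d i * t) (d i * s)) hs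
    refine ⟨v, ?_, ?_⟩
    · rw [← h1]; congr 1; ext ω; simp [Xs, sub_div]
    · rw [h2, div_le_iff₀ hs]
      have := H.potter (d i) |t - s| (hd i).1 (hd i).2 (abs_nonneg _)
      rwa [← mul_sub, abs_mul, abs_of_pos (hd i).1, mul_comm (d i)]
  · intro i t
    have hs := H.pos _ (hd i).1
    obtain ⟨v, h1, h2⟩ := law_div (hJ.1 (d i * t)) (H.nonneg _)
      (single_law H.zero hJ (d i * t)) hs
    refine ⟨v, h1, ?_⟩
    · rw [h2, div_le_iff₀ hs]
      have := H.potter (d i) |t| (hd i).1 (hd i).2 (abs_nonneg _)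
      rwa [abs_mul, abs_of_pos (hd i).1, mul_comm (d i)]

lemma limCov_one (lam t s : ℝ) : limCov lam 1 t s =
    (|t| ^ (2 * lam) + |s| ^ (2 * lam) - |t - s| ^ (2 * lam)) / 2 := by
  simp [limCov]

lemma sqrt_rpow_two {x lam : ℝ} (h : 0 ≤ x) :
    √((x ^ (2 * lam)).toNNReal : ℝ) = x ^ lam := by
  rw [Real.coe_toNNReal _ (by positivity), mul_comm, Real.rpow_mul h]
  norm_cast
  rw [Real.sqrt_sq (by positivity)]

lemma rpow_le_add {x lam a b : ℝ} (hx : 0 ≤ x) (ha : 0 < a) (hal : a < lam) (hlb : lam < b) :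
    x ^ lam ≤ x ^ a + x ^ b := by
  have h1 : 0 ≤ x ^ a := by positivity
  have h2 : 0 ≤ x ^ b := by positivity
  rcases le_total x 1 with h | h
  · rcases hx.eq_or_lt with rfl | hx
    · rw [Real.zero_rpow (by linarith)]; positivity
    · have := Real.rpow_le_rpow_of_exponent_ge hx h hal.le
      linarith
  · have := Real.rpow_le_rpow_of_exponent_le h hlb.le
    linarith

lemma B_bounds {n : ℕ} {B : ℝ → Ω → Fin n → ℝ} {lam a b : ℝ} {ρ : Fin n → Fin n → ℝ}
    (hl : 0 < lam)
    (hρ : ∀ i, ρ i i = 1) (ha : 0 < a) (hal : a < lam) (hlb : lam < b)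
    (hB : IsCenteredGaussianVec P B (limCovMat lam ρ)) :
    (∀ i t s, ∃ v : NNReal, P.map (fun ω => B t ω i - B s ω i) = gaussianReal 0 v ∧
        √(v:ℝ) ≤ |t - s| ^ a + |t - s| ^ b) ∧
    (∀ i t, ∃ v : NNReal, P.map (fun ω => B t ω i) = gaussianReal 0 v ∧
        √(v:ℝ) ≤ |t| ^ a + |t| ^ b) := by
  have h2l : (2 * lam) ≠ 0 := by positivity
  constructor
  · intro i t s
    refine ⟨(|t - s| ^ (2 * lam)).toNNReal, ?_, ?_⟩
    · have h := hB.2 2 ![t, s] ![Pi.single i 1, Pi.single i (-1)]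
      simp only [Fin.sum_univ_two, Matrix.cons_val_zero, Matrix.cons_val_one, Pi.single_apply,
        ite_mul, zero_mul, mul_ite, mul_zero, Finset.sum_ite_eq', Finset.mem_univ, if_true] at h
      simp only [limCovMat, le_refl, if_true, hρ, limCov_one, sub_self, abs_zero, Real.zero_rpow h2l] at h
      convert h using 2
      · ext ω; ring
      · congr 1; rw [abs_sub_comm s t]; ring
    · rw [sqrt_rpow_two (abs_nonneg _)]
      exact rpow_le_add (abs_nonneg _) ha hal hlb
  · intro i t
    refine ⟨(|t| ^ (2 * lam)).toNNReal, ?_, ?_⟩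
    · have h := hB.2 1 ![t] ![Pi.single i 1]
      simp only [Fin.sum_univ_one, Matrix.cons_val_zero, Pi.single_apply,
        ite_mul, zero_mul, mul_ite, mul_zero, Finset.sum_ite_eq', Finset.mem_univ, if_true] at h
      simp only [limCovMat, le_refl, if_true, hρ, limCov_one, sub_self, abs_zero, Real.zero_rpow h2l] at h
      convert h using 2
      · ext ω; ring
      · congr 1; ring
    · rw [sqrt_rpow_two (abs_nonneg _)]
      exact rpow_le_add (abs_nonneg _) ha hal hlb

/-- Scaling identity. -/
lemma Xbar_scale {n : ℕ} {σ : ℝ → ℝ} {J : ℝ → Ω → ℝ} (c : Fin n → ℝ) {d : Fin n → ℝ} {r : ℝ}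
    {i : Fin n} (hd : 0 < d i) (hs : 0 < σ (d i)) (hr : r * d i = σ (d i)) (t : ℝ) (ω : Ω) :
    XbarProc J (c i) r (d i * t) ω / σ (d i) = Refl c (fun t i => Xs σ J d t ω i) t i := by
  unfold XbarProc Refl
  rw [div_eq_mul_inv, Real.iSup_mul_of_nonneg (by positivity)]
  let e : Set.Iio t → Set.Iio (d i * t) := fun s => ⟨d i * s, by
    have := s.2; simp only [Set.mem_Iio] at this ⊢; gcongr⟩
  have he : Function.Surjective e := by
    rintro ⟨s, hs⟩
    simp only [Set.mem_Iio] at hs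
    refine ⟨⟨s / d i, ?_⟩, ?_⟩
    · simp only [Set.mem_Iio]
      rw [div_lt_iff₀ hd]; linarith
    · ext; simp only [e]; field_simp
  rw [← he.iSup_comp]
  congr 1; ext s
  simp only [e, Xs]
  have h1 : r = σ (d i) / d i := by rw [← hr]; field_simp
  rw [h1]
  field_simp

lemma bc_aux [IsFiniteMeasure P] {E : ℕ → Set Ω} (hE : ∀ k, P (E k)ᶜ ≤ ENNReal.ofReal ((1/2) ^ k)) :
    ∀ᵐ ω ∂P, ∀ᶠ k in atTop, ω ∈ E k := by
  have h1 : ∑' k, P (E k)ᶜ ≠ ⊤ := by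
    refine ne_top_of_le_ne_top ?_ (ENNReal.tsum_le_tsum hE)
    rw [← ENNReal.ofReal_tsum_of_nonneg (fun k => by positivity)
      (summable_geometric_of_lt_one (by norm_num) (by norm_num))]
    exact ENNReal.ofReal_ne_top
  filter_upwards [ae_eventually_notMem h1] with ω hω
  filter_upwards [hω] with k hk
  simpa using hk

/-- Measurability of continuous functionals of the reflected process. -/
lemma aemeas_functional [IsFiniteMeasure P] {n : ℕ} {X : ℝ → Ω → Fin n → ℝ} {b q : ℝ}
    (hX : ∀ t i, Measurable fun ω => X t ω i)
    {G : (ℝ → Fin n → ℝ) → ℝ} (hG : ∀ A, 0 ≤ A → ContinuousOn G (KS n A b q)) {M : ℝ}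
    (hM : ∀ f, |G f| ≤ M)
    (ht : ∀ ε > (0:ℝ), ∃ A, 0 ≤ A ∧ ∃ E : Set Ω, P Eᶜ ≤ ENNReal.ofReal ε ∧
        ∀ ω ∈ E, (fun t i => X t ω i) ∈ KS n A b q) :
    AEMeasurable (fun ω => G (fun t i => X t ω i)) P := by
  choose A hA E hE hEK using fun k : ℕ => ht ((1/2) ^ k) (by positivity)
  choose k t g hg hgM hgK using fun j : ℕ => cyl_approx (KS_compact n (A j) b q) (hG _ (hA j)) hM
    (ε := (1/2) ^ j) (by positivity)
  refine aemeasurable_of_tendsto_metrizable_ae atTop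
    (f := fun j ω => g j (fun a i => X (t j a) ω i)) (fun j => ?_) ?_
  · refine ((hg j).measurable.comp ?_).aemeasurable
    refine measurable_pi_lambda _ fun a => measurable_pi_lambda _ fun i => hX _ _
  · filter_upwards [bc_aux hE] with ω hω
    rw [tendsto_iff_dist_tendsto_zero]
    have h0 : Tendsto (fun m : ℕ => (1/2:ℝ) ^ m) atTop (𝓝 0) :=
      tendsto_pow_atTop_nhds_zero_of_lt_one (by norm_num) (by norm_num)
    refine tendsto_of_tendsto_of_tendsto_of_le_of_le' tendsto_const_nhds h0
      (Eventually.of_forall fun _ => dist_nonneg) ?_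
    filter_upwards [hω] with j hj
    rw [dist_comm, Real.dist_eq]
    exact hgK j _ (hEK j ω hj)

lemma int_approx [IsProbabilityMeasure P] {U V : Ω → ℝ} (hU : AEMeasurable U P)
    (hV : AEMeasurable V P) {M ε : ℝ} (hUM : ∀ ω, |U ω| ≤ M) (hVM : ∀ ω, |V ω| ≤ M)
    (hε : 0 ≤ ε) {E : Set Ω} (hE : MeasurableSet E) (hPE : P Eᶜ ≤ ENNReal.ofReal ε)
    (hUV : ∀ ω ∈ E, |U ω - V ω| ≤ ε) :
    |∫ ω, U ω ∂P - ∫ ω, V ω ∂P| ≤ ε + 2 * M * ε := by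
  have hM0 : 0 ≤ M := by
    obtain ⟨ω⟩ := nonempty_of_isProbabilityMeasure P
    exact (abs_nonneg _).trans (hUM ω)
  have hUi : Integrable U P := Integrable.of_bound hU.aestronglyMeasurable M (ae_of_all _ hUM)
  have hVi : Integrable V P := Integrable.of_bound hV.aestronglyMeasurable M (ae_of_all _ hVM)
  rw [← integral_sub hUi hVi]
  have hi : Integrable (fun ω => ε + Eᶜ.indicator (fun _ => 2 * M) ω) P :=
    (integrable_const _).add ((integrable_const _).indicator hE.compl)
  calc |∫ ω, (U ω - V ω) ∂P| ≤ ∫ ω, |U ω - V ω| ∂P := abs_integral_le_integral_abs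
    _ ≤ ∫ ω, (ε + Eᶜ.indicator (fun _ => 2 * M) ω) ∂P := by
      refine integral_mono (hUi.sub hVi).abs hi fun ω => ?_
      by_cases h : ω ∈ E
      · simpa [h] using hUV ω h
      · simp only [Set.mem_compl_iff, h, not_false_eq_true, Set.indicator_of_mem]
        have := abs_sub (U ω) (V ω)
        linarith [hUM ω, hVM ω]
    _ = ε + 2 * M * P.real Eᶜ := by
      rw [integral_add (integrable_const _) ((integrable_const _).indicator hE.compl),
        integral_indicator hE.compl]
      simp [mul_comm]
    _ ≤ _ := by
      have : P.real Eᶜ ≤ ε := ENNReal.toReal_le_of_le_ofReal hε hPE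
      gcongr
end

open MeasureTheory ProbabilityTheory Filter Topology

lemma covFromStd_symm (σ : ℝ → ℝ) (t s : ℝ) : covFromStd σ t s = covFromStd σ s t := by
  unfold covFromStd; rw [abs_sub_comm]; ring

theorem sup_convergence_light
    {Ω Ω' : Type*} [MeasurableSpace Ω] [MeasurableSpace Ω']
    (P : Measure Ω) (P' : Measure Ω')
    [IsProbabilityMeasure P] [IsProbabilityMeasure P']
    {n : ℕ} (hn : 0 < n)
    (σ : ℝ → ℝ) (hσcont : ContinuousOn σ (Set.Ici 0)) (hσ0 : σ 0 = 0)
    (hσpos : ∀ t > (0:ℝ), 0 < σ t)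
    (J : ℝ → Ω → ℝ) (hJcont : ∀ ω, Continuous fun t => J t ω)
    (hJ0 : ∀ ω, J 0 ω = 0)
    (hJgauss : IsCenteredGaussian1 P J (covFromStd σ))
    -- assumption L1
    (lam : ℝ) (hlam : lam ∈ Set.Ioo (0:ℝ) 1)
    (hL1 : ∀ t > (0:ℝ), Tendsto (fun x => σ (t * x) / σ x) (𝓝[>] 0) (𝓝 (t ^ lam)))
    -- assumption L2
    (t₀ β C : ℝ) (ht₀ : 0 < t₀) (hβ : β ∈ Set.Ioo (0:ℝ) 1) (hC : 0 < C)
    (hL2 : ∀ t > t₀, σ t ≤ C * t ^ β)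
    -- the routing matrix: strictly upper triangular, nonnegative entries,
    -- at most one positive entry per column
    (Pm : Matrix (Fin n) (Fin n) ℝ)
    (hPnn : ∀ i j, 0 ≤ Pm i j)
    (hPut : ∀ i j, j ≤ i → Pm i j = 0)
    (hPcol : ∀ j i i', 0 < Pm i j → 0 < Pm i' j → i = i')
    (r : Fin n → ℝ → ℝ)
    (hrpos : ∀ i, ∀ u > (0:ℝ), 0 < r i u)
    (hrmono : ∀ i, Monotone (r i) ∨ Antitone (r i))
    (hrlim : ∀ i, Tendsto (r i) atTop atTop)
    -- assumption N1
    (hN1 : ∀ i j, 0 < Pm i j → ∀ u > (0:ℝ), r j u < Pm i j * r i u)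
    -- assumption N3
    (ρ : Fin n → Fin n → ℝ)
    (hρmem : ∀ i j, i ≤ j → ρ i j ∈ Set.Icc (0:ℝ) 1)
    (hN3 : ∀ i j, i ≤ j → Tendsto (fun u => r j u / r i u) atTop (𝓝 (ρ i j)))
    -- the scaling function δ, solving x δ(x) = σ(δ(x)) near ∞
    (δ : ℝ → ℝ) (hδ : ∀ᶠ x in atTop, 0 < δ x ∧ x * δ x = σ (δ x))
    -- the limiting n-dimensional Gaussian process B_λ
    (B : ℝ → Ω' → Fin n → ℝ)
    (hBcont : ∀ ω i, Continuous fun t => B t ω i)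
    (hBgauss : IsCenteredGaussianVec P' B (limCovMat lam ρ)) :
    -- conclusion: X̄ᵟ_u → 𝔛_λ in distribution in C([0,∞) → ℝⁿ)
    TendstoInDistOnCompacts P P' (Set.Ici 0) n
      (fun u ω t i =>
        XbarProc J ((1 - Pm.transpose)⁻¹ i ⟨0, hn⟩) (r i u) (δ (r i u) * t) ω
          / σ (δ (r i u)))
      (fun ω t i =>
        ⨆ s : Set.Iio t,
          ((1 - Pm.transpose)⁻¹ i ⟨0, hn⟩ * (B t ω i - B (↑s) ω i) - (t - ↑s))) := by
  obtain ⟨K, a, b, dd, H⟩ := sigHyp_of hσcont hσ0 hσpos hJgauss hlam hL1 ht₀ hβ hC hL2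
  have hδ0 := delta_tendsto hσcont ht₀ hβ hC hL2 hδ
  set d : ℝ → Fin n → ℝ := fun u i => δ (r i u) with hd
  have hdi : ∀ i, Tendsto (fun u => d u i) atTop (𝓝[>] 0) := fun i => hδ0.comp (hrlim i)
  have hρii : ∀ i, ρ i i = 1 := by
    intro i
    refine tendsto_nhds_unique (hN3 i i le_rfl) ?_
    refine tendsto_const_nhds.congr' ?_
    filter_upwards [eventually_gt_atTop 0] with u hu
    rw [div_self (hrpos i u hu).ne']
  have hrd : ∀ i, ∀ᶠ u in atTop, 0 < d u i ∧ r i u * d u i = σ (d u i) := fun i =>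
    (hrlim i).eventually hδ
  have hr0 : ∀ i, ∀ᶠ u in atTop, σ (d u i) / d u i = r i u := by
    intro i
    filter_upwards [hrd i] with u hu
    rw [← hu.2, mul_div_assoc, div_self hu.1.ne', mul_one]
  -- covariance convergence
  have hcov0 : ∀ i j, i ≤ j → ∀ t s, Tendsto (fun u => covFromStd σ (d u i * t) (d u j * s) /
      (σ (d u i) * σ (d u j))) atTop (𝓝 (limCov lam (ρ i j) t s)) := by
    intro i j hij t s
    refine H.cov_tendsto (hdi i) (hdi j) (hρmem i j hij).1 ?_ t s
    refine (hN3 i j hij).congr' ?_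
    filter_upwards [hr0 i, hr0 j] with u h1 h2
    rw [h1, h2]
  have hcov : ∀ i j t s, Tendsto (fun u => covFromStd σ (d u i * t) (d u j * s) /
      (σ (d u i) * σ (d u j))) atTop (𝓝 (limCovMat lam ρ i j t s)) := by
    intro i j t s
    unfold limCovMat
    split_ifs with hij
    · exact hcov0 i j hij t s
    · refine (hcov0 j i (le_of_not_ge hij) s t).congr fun u => ?_
      rw [covFromStd_symm, mul_comm (σ (d u j))]
  set c : Fin n → ℝ := fun i => (1 - Pm.transpose)⁻¹ i ⟨0, hn⟩ with hc
  intro F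
  set M := ‖F‖ with hMdef
  have hM0 : 0 ≤ M := norm_nonneg _
  set G : (ℝ → Fin n → ℝ) → ℝ := fun f => F (ReflU c f) with hGdef
  have hGM : ∀ f, |G f| ≤ M := fun f => F.norm_coe_le_norm _
  set q := (2:ℝ) ^ (-(a/4)) with hq
  have ha := H.a0
  have hq0 : 0 ≤ q := by positivity
  have hq1 : q < 1 := Real.rpow_lt_one_of_one_lt_of_neg (by norm_num) (by linarith)
  have hb0 := H.b0
  have hb1 := H.b1
  have hab : a < b := H.al.trans H.lb
  have hG : ∀ A, 0 ≤ A → ContinuousOn G (KS n A ((1 + b) / 2) q) := fun A hA =>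
    F.continuous.comp_continuousOn
      (ReflU_continuousOn c (by linarith) hA (by linarith) hq0 hq1)
  -- the good range of u
  have hgood : ∀ᶠ u in atTop, ∀ i, (0 < d u i ∧ d u i ≤ dd) ∧ r i u * d u i = σ (d u i) := by
    rw [eventually_all]
    intro i
    filter_upwards [ev_small H.d0 (hdi i), hrd i] with u h1 h2 using ⟨h1, h2.2⟩
  have hXcont : ∀ u ω i, Continuous fun t => Xs σ J (d u) t ω i := by
    intro u ω i
    have h1 : Continuous fun t => J (d u i * t) ω :=
      (hJcont ω).comp (continuous_const.mul continuous_id)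
    exact h1.div_const _
  have hXmeas : ∀ u t i, Measurable fun ω => Xs σ J (d u) t ω i := fun u t i =>
    (hJgauss.1 _).div_const _
  obtain ⟨hBi, hBs⟩ := B_bounds (P := P') hlam.1 hρii ha H.al H.lb hBgauss
  have hK1 : (0:ℝ) ≤ 1 := zero_le_one
  have htight : ∀ ε > (0:ℝ), ∃ A, 0 ≤ A ∧
      (∃ E : Set Ω', MeasurableSet E ∧ P' Eᶜ ≤ ENNReal.ofReal ε ∧
        ∀ ω ∈ E, (fun t i => B t ω i) ∈ KS n A ((1 + b) / 2) q) ∧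
      ∀ u, (∀ i, (0 < d u i ∧ d u i ≤ dd) ∧ r i u * d u i = σ (d u i)) →
      (∃ E : Set Ω, MeasurableSet E ∧ P Eᶜ ≤ ENNReal.ofReal ε ∧
        ∀ ω ∈ E, (fun t i => Xs σ J (d u) t ω i) ∈ KS n A ((1 + b) / 2) q) := by
    intro ε hε
    obtain ⟨A1, hA1, h1⟩ := prob_KS ha hab hb1 zero_le_one n hε
    obtain ⟨A2, hA2, h2⟩ := prob_KS ha hab hb1 H.K0.le n hε
    refine ⟨max A1 A2, hA1.trans (le_max_left _ _), ?_, ?_⟩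
    · obtain ⟨E, hE1, hE2, hE3⟩ := h1 P' B hBcont hBgauss.1
        (fun i t s => by simpa only [one_mul] using hBi i t s)
        (fun i t => by simpa only [one_mul] using hBs i t)
      exact ⟨E, hE1, hE2, fun ω hω => KS_mono (le_max_left _ _) hq0 (hE3 ω hω)⟩
    · intro u hu
      obtain ⟨hXi, hXs⟩ := Xs_bounds H hJgauss (d := d u) (fun i => (hu i).1)
      obtain ⟨E, hE1, hE2, hE3⟩ := h2 P (Xs σ J (d u)) (hXcont u) (hXmeas u) hXi hXs
      exact ⟨E, hE1, hE2, fun ω hω => KS_mono (le_max_right _ _) hq0 (hE3 ω hω)⟩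
  -- measurability
  have hBG : AEMeasurable (fun ω => G (fun t i => B t ω i)) P' := by
    refine aemeas_functional hBgauss.1 hG hGM fun ε hε => ?_
    obtain ⟨A, hA, ⟨E, h1, h2, h3⟩, -⟩ := htight ε hε
    exact ⟨A, hA, E, h2, h3⟩
  have hXG : ∀ u, (∀ i, (0 < d u i ∧ d u i ≤ dd) ∧ r i u * d u i = σ (d u i)) →
      AEMeasurable (fun ω => G (fun t i => Xs σ J (d u) t ω i)) P := by
    intro u hu
    refine aemeas_functional (hXmeas u) hG hGM fun ε hε => ?_
    obtain ⟨A, hA, -, h⟩ := htight ε hε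
    obtain ⟨E, h1, h2, h3⟩ := h u hu
    exact ⟨A, hA, E, h2, h3⟩
  -- finite dimensional convergence
  have hfidi : ∀ (k : ℕ) (t : Fin k → ℝ) (g : (Fin k → Fin n → ℝ) → ℝ), Continuous g →
      (∀ x, |g x| ≤ M) → Tendsto (fun u => ∫ ω, g (fun m i => Xs σ J (d u) (t m) ω i) ∂P) atTop
        (𝓝 (∫ ω, g (fun m i => B (t m) ω i) ∂P')) := by
    intro k t g hg hgM
    refine tendsto_of_seq_tendsto fun v hv => ?_
    refine gauss_conv (ι := Fin k × Fin n)
      (Y := fun z ω x => Xs σ J (d (v z)) (t x.1) ω x.2) (Z := fun ω x => B (t x.1) ω x.2)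
      (fun z => measurable_pi_lambda _ fun x => hXmeas _ _ _)
      (measurable_pi_lambda _ fun x => hBgauss.1 _ _)
      (fun z cc => Xs_law hJgauss (d (v z)) t cc) (fun cc => B_law hBgauss t cc) (fun cc => ?_)
      (g := fun x => g (fun m i => x (m, i))) (by fun_prop) (M := M) (fun x => hgM _)
    refine tendsto_finsetSum _ fun x _ => tendsto_finsetSum _ fun y _ => ?_
    exact ((hcov x.2 y.2 (t x.1) (t y.1)).comp hv).const_mul _
  -- conclusion
  have hmain : Tendsto (fun u => ∫ ω, G (fun t i => Xs σ J (d u) t ω i) ∂P) atTop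
      (𝓝 (∫ ω, G (fun t i => B t ω i) ∂P')) := by
    rw [Metric.tendsto_nhds]
    intro η hη
    set ε := η / (4 * (2 + 2 * M)) with hε
    have hε0 : 0 < ε := by positivity
    obtain ⟨A, hA, ⟨E, hE1, hE2, hE3⟩, hX⟩ := htight ε hε0
    obtain ⟨k, t, g, hg, hgM, hgK⟩ :=
      cyl_approx (KS_compact n A ((1 + b) / 2) q) (hG A hA) hGM hε0
    have hgB : Measurable fun ω => g (fun m i => B (t m) ω i) :=
      hg.measurable.comp (measurable_pi_lambda _ fun m => measurable_pi_lambda _ fun i =>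
        hBgauss.1 _ _)
    have hB3 := int_approx hBG hgB.aemeasurable (fun ω => hGM _) (fun ω => hgM _) hε0.le hE1 hE2
      (fun ω hω => hgK _ (hE3 ω hω))
    have hconv := (Metric.tendsto_nhds.1 (hfidi k t g hg hgM)) ε hε0
    filter_upwards [hgood, hconv] with u hu hcu
    obtain ⟨E', hE1', hE2', hE3'⟩ := hX u hu
    have hgX : Measurable fun ω => g (fun m i => Xs σ J (d u) (t m) ω i) :=
      hg.measurable.comp (measurable_pi_lambda _ fun m => measurable_pi_lambda _ fun i =>
        hXmeas _ _ _)
    have hX3 := int_approx (hXG u hu) hgX.aemeasurable (fun ω => hGM _) (fun ω => hgM _) hε0.le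
      hE1' hE2' (fun ω hω => hgK _ (hE3' ω hω))
    rw [Real.dist_eq] at hcu ⊢
    have h1 := abs_le.1 hX3
    have h2 := abs_le.1 hB3
    have h3 := abs_lt.1 hcu
    have h4 : 4 * (ε * (2 + 2 * M)) = η := by rw [hε]; field_simp
    have h5 : 0 ≤ M * ε := by positivity
    rw [abs_lt]; constructor <;> nlinarith
  refine hmain.congr' ?_
  filter_upwards [hgood] with u hu
  refine integral_congr_ae (ae_of_all _ fun ω => ?_)
  simp only [hGdef]
  congr 1
  unfold ReflU
  congr 1
  ext t i
  exact (Xbar_scale c (hu i).1.1 (H.pos _ (hu i).1.1) (hu i).2 t ω).symm
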